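/- Let T : ℝ[z₁,…,zₙ] → ℝ[z₁,…,zₙ] be a linear operator. Then T preserves real stability (i.e., for every real stable f the polynomial T(f) is real stable or identically zero) if and only if either (a) T has range of dimension at most two and is of the form T(f) = α(f)·P + β(f)·Q, where α, β : ℝ[z₁,…,zₙ] → ℝ are linear functionals and P, Q are real stable polynomials with P ≪ Q, or (b) Ḡ_T(z,w) = Σ_{α ∈ ℕⁿ} (−1)^{|α|} T(z^α) w^α/α! converges on ℂ^{2n} to an entire function in the Laguerre–Pólya class in 2n variables, or (c) Ḡ_T(z,−w) converges on ℂ^{2n} to an entire function in the Laguerre–Pólya class in 2n variables. -/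

import Mathlib

open MvPolynomial

/-- A complex polynomial is *stable* if it is non-vanishing whenever all
variables lie in the open upper half-plane. -/
def IsStable {σ : Type*} (f : MvPolynomial σ ℂ) : Prop :=
  ∀ z : σ → ℂ, (∀ i, 0 < (z i).im) → MvPolynomial.eval z f ≠ 0

/-- A real polynomial is *real stable* if it is non-vanishing whenever all
variables lie in the open upper half-plane. -/
def IsRealStable {σ : Type*} (f : MvPolynomial σ ℝ) : Prop :=
  ∀ z : σ → ℂ, (∀ i, 0 < (z i).im) → MvPolynomial.aeval z f ≠ 0

/-- `ProperPosition f g` means `f ≪ g`, i.e. `g + i·f` is stable. -/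
def ProperPosition {σ : Type*} (f g : MvPolynomial σ ℝ) : Prop :=
  IsStable (MvPolynomial.map (algebraMap ℝ ℂ) g +
    Complex.I • MvPolynomial.map (algebraMap ℝ ℂ) f)

/-- The general term `ε^{|α|} T(z^α)(z) · w^α / α!` of the transcendental
symbol `Ḡ_T(z, ε·w) = ∑_{α} (-ε)^{|α|} ... `; for `ε = -1` this gives the terms
of `Ḡ_T(z,w) = ∑_α (-1)^{|α|} T(z^α) w^α/α!` and for `ε = 1` the terms of
`Ḡ_T(z,-w)`, evaluated at a point `zw ∈ ℂ^{2n}` (the `z`-coordinates indexed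
by `Sum.inl`, the `w`-coordinates by `Sum.inr`). -/
noncomputable def transSymbolTermR {n : ℕ} (ε : ℂ)
    (T : MvPolynomial (Fin n) ℝ →ₗ[ℝ] MvPolynomial (Fin n) ℝ)
    (α : Fin n →₀ ℕ) (zw : Fin n ⊕ Fin n → ℂ) : ℂ :=
  (ε ^ (α.sum fun _ k => k) / (α.prod fun _ k => (k.factorial : ℂ))) *
    MvPolynomial.aeval (zw ∘ Sum.inl) (T (monomial α 1)) *
      ∏ i, zw (Sum.inr i) ^ α i

/-- `F : ℂ^{2n} → ℂ` belongs to the (real) Laguerre–Pólya class: it is a limit,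
uniformly on compact subsets of `ℂ^{2n}`, of real stable polynomials in `2n`
variables. -/
def InLaguerrePolyaR (n : ℕ) (F : (Fin n ⊕ Fin n → ℂ) → ℂ) : Prop :=
  ∃ g : ℕ → MvPolynomial (Fin n ⊕ Fin n) ℝ,
    (∀ k, IsRealStable (g k)) ∧
    ∀ K : Set (Fin n ⊕ Fin n → ℂ), IsCompact K →
      TendstoUniformlyOn (fun k zw => MvPolynomial.aeval zw (g k)) F
        Filter.atTop K

namespace RealStability

open Filter Topology

section Basic

variable {σ : Type*}

/-- The product of upper half-planes. -/
def upperHalf (σ : Type*) : Set (σ → ℂ) := {z | ∀ i, 0 < (z i).im}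

/-- A complex polynomial that is stable or identically zero. -/
def StableOrZero (f : MvPolynomial σ ℂ) : Prop := IsStable f ∨ f = 0

lemma isOpen_upperHalf [Finite σ] : IsOpen (upperHalf σ) := by
  have : upperHalf σ = ⋂ i, {z : σ → ℂ | 0 < (z i).im} := by
    ext z; simp [upperHalf]
  rw [this]
  exact isOpen_iInter_of_finite fun i =>
    isOpen_lt continuous_const (Complex.continuous_im.comp (continuous_apply i))

lemma convex_upperHalf : Convex ℝ (upperHalf σ) := by
  have : upperHalf σ = ⋂ i, {z : σ → ℂ | 0 < (z i).im} := by
    ext z; simp [upperHalf]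
  rw [this]
  refine convex_iInter fun i => ?_
  intro x hx y hy a b ha hb hab
  simp only [Set.mem_ofPred_eq] at *
  simp only [Pi.add_apply, Pi.smul_apply, Complex.add_im, Complex.smul_im, smul_eq_mul]
  rcases ha.eq_or_lt with h | h
  · have : b = 1 := by linarith
    subst h; subst this; simpa using hy
  · have := mul_pos h hx
    have := mul_nonneg hb hy.le
    linarith

lemma const_I_mem_upperHalf : (fun _ => Complex.I) ∈ upperHalf σ := fun i => by simp

lemma isRealStable_iff {f : MvPolynomial σ ℝ} :
    IsRealStable f ↔ IsStable (map (algebraMap ℝ ℂ) f) := by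
  simp only [IsRealStable, IsStable, eval_map, aeval_def]

lemma eq_zero_of_eval_eq_zero {f : MvPolynomial σ ℂ}
    (h : ∀ z ∈ upperHalf σ, eval z f = 0) : f = 0 := by
  refine funext_set (fun _ => {w : ℂ | 0 < w.im}) (fun i => ?_) fun z hz => ?_
  · refine Set.infinite_of_injective_forall_mem (f := fun n : ℕ => (n : ℂ) + Complex.I) ?_ ?_
    · intro a b h; simpa using h
    · intro a; simp
  · simpa using h z fun i => hz i (Set.mem_univ i)

lemma eval_conj_map (p : MvPolynomial σ ℝ) (z : σ → ℂ) :
    eval (fun i => (starRingEnd ℂ) (z i)) (map (algebraMap ℝ ℂ) p) =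
      (starRingEnd ℂ) (eval z (map (algebraMap ℝ ℂ) p)) := by
  induction p using MvPolynomial.induction_on with
  | C a => simp
  | add p q hp hq => simp [hp, hq]
  | mul_X p i hp => simp [hp]

/-- Restriction of a polynomial to an affine line. -/
noncomputable def lineRestrict (x y : σ → ℂ) (f : MvPolynomial σ ℂ) : Polynomial ℂ :=
  aeval (fun i => Polynomial.C (x i) + Polynomial.C (y i) * Polynomial.X) f

lemma eval_lineRestrict (x y : σ → ℂ) (f : MvPolynomial σ ℂ) (t : ℂ) :
    (lineRestrict x y f).eval t = eval (fun i => x i + y i * t) f := by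
  unfold lineRestrict
  induction f using MvPolynomial.induction_on with
  | C a => simp
  | add p q hp hq => simp [hp, hq]
  | mul_X p i hp => simp [hp]

end Basic

section Univariate

open Polynomial in
/-- A univariate polynomial without zeros in the upper half-plane factors through
linear factors with roots in the closed lower half-plane. -/
lemma exists_multiset_of_ne_zero {q : ℂ[X]} (hq : ∀ t : ℂ, 0 < t.im → q.eval t ≠ 0) :
    ∃ s : Multiset ℂ, (∀ a ∈ s, a.im ≤ 0) ∧ q.leadingCoeff ≠ 0 ∧
      q = Polynomial.C q.leadingCoeff *
        (s.map fun a => Polynomial.X - Polynomial.C a).prod := by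
  have hq0 : q ≠ 0 := by
    rintro rfl
    exact hq Complex.I (by simp) (by simp)
  refine ⟨q.roots, fun a ha => ?_, by simpa using hq0, ?_⟩
  · by_contra! h
    exact hq a h ((mem_roots hq0).1 ha)
  · exact (IsAlgClosed.splits q).eq_prod_roots

open Polynomial in
lemma norm_eval_conj_le {q : ℂ[X]} (hq : ∀ t : ℂ, 0 < t.im → q.eval t ≠ 0) {t : ℂ}
    (ht : 0 ≤ t.im) : ‖q.eval ((starRingEnd ℂ) t)‖ ≤ ‖q.eval t‖ := by
  obtain ⟨s, hs, -, hqs⟩ := exists_multiset_of_ne_zero hq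
  rw [hqs]
  simp only [Polynomial.eval_mul, Polynomial.eval_C, norm_mul]
  gcongr
  clear hqs
  induction s using Multiset.induction_on with
  | empty => simp
  | cons a s ih =>
    simp only [Multiset.map_cons, Multiset.prod_cons, Polynomial.eval_mul, norm_mul]
    refine mul_le_mul ?_ (ih fun b hb => hs b (by simp [hb])) (norm_nonneg _) (norm_nonneg _)
    have ha := hs a (by simp)
    rw [← sq_le_sq₀ (norm_nonneg _) (norm_nonneg _), Complex.sq_norm, Complex.sq_norm,
      Complex.normSq_apply, Complex.normSq_apply]
    simp
    nlinarith

open Polynomial in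
lemma im_derivative_mul_conj_le {q : ℂ[X]} (hq : ∀ t : ℂ, 0 < t.im → q.eval t ≠ 0) {t : ℂ}
    (ht : 0 < t.im) : (q.derivative.eval t / q.eval t).im ≤ 0 := by
  rw [(IsAlgClosed.splits q).eval_derivative_div_eval_of_ne_zero (hq t ht)]
  have hs : ∀ a ∈ q.roots, a.im ≤ 0 := by
    intro a ha
    by_contra! h
    exact hq a h (Polynomial.isRoot_of_mem_roots ha)
  generalize q.roots = s at hs
  induction s using Multiset.induction_on with
  | empty => simp
  | cons a s ih =>
    simp only [Multiset.map_cons, Multiset.sum_cons, Complex.add_im]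
    have h1 := ih fun b hb => hs b (by simp [hb])
    have ha := hs a (by simp)
    have : (1 / (t - a)).im ≤ 0 := by
      rw [one_div, Complex.inv_im]
      apply div_nonpos_of_nonpos_of_nonneg
      · simp; linarith
      · exact Complex.normSq_nonneg _
    linarith

end Univariate

section Multivariate

variable {σ : Type*}

lemma norm_eval_conj_le_mv {f : MvPolynomial σ ℂ} (hf : IsStable f) {z : σ → ℂ}
    (hz : z ∈ upperHalf σ) :
    ‖eval (fun i => (starRingEnd ℂ) (z i)) f‖ ≤ ‖eval z f‖ := by
  have h := norm_eval_conj_le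
    (q := lineRestrict (fun i => ((z i).re : ℂ)) (fun i => ((z i).im : ℂ)) f) (t := Complex.I)
    (fun t ht => by
      rw [eval_lineRestrict]
      refine hf _ fun i => ?_
      simpa using mul_pos (hz i) ht) (by simp)
  rw [eval_lineRestrict, eval_lineRestrict] at h
  have e1 : (fun i => ((z i).re : ℂ) + ((z i).im : ℂ) * Complex.I) = z := by
    ext i; exact Complex.re_add_im (z i)
  have e2 : (fun i => ((z i).re : ℂ) + ((z i).im : ℂ) * (starRingEnd ℂ) Complex.I) =
      fun i => (starRingEnd ℂ) (z i) := by
    ext i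
    apply Complex.ext <;> simp
  rwa [e1, e2] at h

lemma differentiable_eval [Fintype σ] (f : MvPolynomial σ ℂ) :
    Differentiable ℂ fun z : σ → ℂ => eval z f := by
  induction f using MvPolynomial.induction_on with
  | C a => simp
  | add p q hp hq =>
    simp only [map_add]
    exact hp.fun_add hq
  | mul_X p i hp =>
    simp only [map_mul, eval_X]
    exact hp.fun_mul (differentiable_apply i)

/-- The imaginary part of a stable polynomial is real stable or zero. -/
lemma stableOrZero_of_stable_add_I [Fintype σ] {p q : MvPolynomial σ ℝ}
    (h : IsStable (map (algebraMap ℝ ℂ) p + Complex.I • map (algebraMap ℝ ℂ) q)) :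
    IsRealStable q ∨ q = 0 := by
  by_cases hq : IsRealStable q
  · exact Or.inl hq
  right
  rw [isRealStable_iff] at hq
  simp only [IsStable, not_forall, not_not] at hq
  obtain ⟨z₀, hz₀, hqz⟩ := hq
  set P := map (algebraMap ℝ ℂ) p with hP
  set Q := map (algebraMap ℝ ℂ) q with hQ
  have hne : ∀ z ∈ upperHalf σ, eval z P + Complex.I * eval z Q ≠ 0 := fun z hz => by
    simpa [smul_eval] using h z hz
  have hle : ∀ z ∈ upperHalf σ,
      ‖eval z P - Complex.I * eval z Q‖ ≤ ‖eval z P + Complex.I * eval z Q‖ := fun z hz => by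
    have := norm_eval_conj_le_mv h hz
    simp only [map_add, smul_eval] at this
    rw [hP, hQ, eval_conj_map, eval_conj_map] at this
    have e : (starRingEnd ℂ) (eval z P) + Complex.I * (starRingEnd ℂ) (eval z Q) =
      (starRingEnd ℂ) (eval z P - Complex.I * eval z Q) := by simp
    rwa [← hP, ← hQ, e, RCLike.norm_conj] at this
  set B : (σ → ℂ) → ℂ := fun z =>
    (eval z P - Complex.I * eval z Q) / (eval z P + Complex.I * eval z Q) with hB
  have hdiff : DifferentiableOn ℂ B (upperHalf σ) := by
    simp only [hB, div_eq_mul_inv]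
    exact ((differentiable_eval P).fun_sub
      ((differentiable_eval Q).const_mul Complex.I)).differentiableOn.fun_mul
      (((differentiable_eval P).fun_add
        ((differentiable_eval Q).const_mul Complex.I)).differentiableOn.fun_inv hne)
  have hB0 : B z₀ = 1 := by
    have := hne z₀ hz₀
    simp only [hB, hqz, mul_zero, add_zero, sub_zero] at this ⊢
    exact div_self this
  have hmax : IsMaxOn (norm ∘ B) (upperHalf σ) z₀ := by
    intro z hz
    simp only [Function.comp, Set.mem_ofPred_eq, hB0, norm_one]
    rw [hB, norm_div]
    exact div_le_one_of_le₀ (hle z hz) (norm_nonneg _)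
  have hconst := Complex.eqOn_of_isPreconnected_of_isMaxOn_norm
    convex_upperHalf.isPreconnected isOpen_upperHalf hdiff hz₀ hmax
  have hQ0 : Q = 0 := eq_zero_of_eval_eq_zero fun z hz => by
    have h1 := hconst hz
    simp only [Function.const_apply, hB0] at h1
    rw [hB, div_eq_one_iff_eq (hne z hz)] at h1
    have : 2 * Complex.I * eval z Q = 0 := by linear_combination -h1
    simpa using this
  exact (map_eq_zero_iff _ (map_injective _ (algebraMap ℝ ℂ).injective)).1 hQ0

/-- Real linear combinations of the real and imaginary part of a stable polynomial are real
stable or zero. -/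
lemma stableOrZero_combination [Fintype σ] {p q : MvPolynomial σ ℝ}
    (h : IsStable (map (algebraMap ℝ ℂ) p + Complex.I • map (algebraMap ℝ ℂ) q)) (a b : ℝ) :
    IsRealStable (a • p + b • q) ∨ a • p + b • q = 0 := by
  by_cases hab : (b : ℂ) + a * Complex.I = 0
  · have hb : b = 0 := by simpa using congrArg Complex.re hab
    have ha : a = 0 := by simpa using congrArg Complex.im hab
    right; simp [ha, hb]
  refine stableOrZero_of_stable_add_I (p := b • p - a • q) fun z hz => ?_
  have e : eval z (map (algebraMap ℝ ℂ) (b • p - a • q) +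
      Complex.I • map (algebraMap ℝ ℂ) (a • p + b • q)) =
      ((b : ℂ) + a * Complex.I) *
        eval z (map (algebraMap ℝ ℂ) p + Complex.I • map (algebraMap ℝ ℂ) q) := by
    simp [MvPolynomial.smul_eq_C_mul]
    linear_combination (-(a : ℂ) * eval₂ (Complex.ofRealHom) z q) * Complex.I_sq
  rw [e]
  exact mul_ne_zero hab (h z hz)

end Multivariate

section Hurwitz

variable {σ : Type*}

lemma StableOrZero.ne_zero {f : MvPolynomial σ ℂ} (hf : StableOrZero f) {z w : σ → ℂ}
    (hz : z ∈ upperHalf σ) (hw : eval w f ≠ 0) : eval z f ≠ 0 := by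
  rcases hf with hf | rfl
  · exact hf z hz
  · simp at hw

/-- Hurwitz' theorem for stable polynomials. -/
lemma stableOrZero_of_tendsto [Fintype σ] {f : ℕ → MvPolynomial σ ℂ} {g : MvPolynomial σ ℂ}
    (hf : ∀ᶠ k in atTop, StableOrZero (f k))
    (h : ∀ K : Set (σ → ℂ), IsCompact K →
      TendstoUniformlyOn (fun k z => eval z (f k)) (fun z => eval z g) atTop K) :
    StableOrZero g := by
  by_contra hg
  rw [StableOrZero, not_or] at hg
  obtain ⟨hgs, hg0⟩ := hg
  simp only [IsStable, not_forall, not_not] at hgs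
  obtain ⟨z₀, hz₀, hgz₀⟩ := hgs
  obtain ⟨z₁, hz₁, hgz₁⟩ : ∃ z ∈ upperHalf σ, eval z g ≠ 0 := by
    by_contra! hcon
    exact hg0 (eq_zero_of_eval_eq_zero hcon)
  set L : ℂ → σ → ℂ := fun t i => z₀ i + (z₁ i - z₀ i) * t with hL
  have hLc : Continuous L := by fun_prop
  set q : Polynomial ℂ := lineRestrict z₀ (z₁ - z₀) g with hq
  have hqe : ∀ t, q.eval t = eval (L t) g := fun t => eval_lineRestrict _ _ _ _
  have hL0 : L 0 = z₀ := by simp [hL]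
  have hL1 : L 1 = z₁ := by simp [hL]
  have hq0 : q ≠ 0 := by
    intro h0
    apply hgz₁
    rw [← hL1, ← hqe, h0, Polynomial.eval_zero]
  have hroot : ∀ᶠ t in 𝓝 (0 : ℂ), t ∈ (((q.roots.toFinset.erase 0 : Finset ℂ) : Set ℂ)ᶜ) :=
    (Finset.finite_toSet _).isClosed.isOpen_compl.mem_nhds (by simp)
  have hdom : ∀ᶠ t in 𝓝 (0 : ℂ), L t ∈ upperHalf σ :=
    hLc.continuousAt.eventually_mem (isOpen_upperHalf.mem_nhds (by rwa [hL0]))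
  obtain ⟨δ, hδ, hball⟩ := Metric.eventually_nhds_iff.1 (hroot.and hdom)
  set r := δ / 2 with hr
  have hr0 : 0 < r := by positivity
  have hin : ∀ t ∈ Metric.closedBall (0 : ℂ) r, L t ∈ upperHalf σ := fun t ht =>
    (hball (lt_of_le_of_lt (Metric.mem_closedBall.1 ht) (by linarith))).2
  have hsph : ∀ t ∈ Metric.sphere (0 : ℂ) r, eval (L t) g ≠ 0 := fun t ht h0 => by
    have h1 := (hball (lt_of_le_of_lt (Metric.mem_sphere.1 ht).le (by linarith))).1
    apply h1
    have : t ≠ 0 := by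
      rintro rfl
      simp at ht
      linarith
    simp [this, hq0, Polynomial.IsRoot, hqe, h0]
  obtain ⟨t₀, ht₀, hmin⟩ := (isCompact_sphere (0 : ℂ) r).exists_isMinOn
    (NormedSpace.sphere_nonempty.2 hr0.le)
    (f := fun t => ‖eval (L t) g‖)
    (((differentiable_eval g).continuous.comp hLc).norm.continuousOn)
  set m := ‖eval (L t₀) g‖ with hm
  have hm0 : 0 < m := norm_pos_iff.2 (hsph t₀ ht₀)
  have hK : IsCompact (L '' Metric.closedBall (0 : ℂ) r) := (isCompact_closedBall _ _).image hLc
  have hu := Metric.tendstoUniformlyOn_iff.1 (h _ hK) (m / 2) (by positivity)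
  have hu1 := Metric.tendstoUniformlyOn_iff.1 (h {z₁} isCompact_singleton) ‖eval z₁ g‖
    (norm_pos_iff.2 hgz₁)
  obtain ⟨k, hk, hk1, hfk⟩ := (hu.and (hu1.and hf)).exists
  have hk1' : eval z₁ (f k) ≠ 0 := by
    intro h0
    have := hk1 z₁ rfl
    rw [h0, dist_zero_right] at this
    exact lt_irrefl _ this
  have hnz : ∀ t ∈ Metric.closedBall (0 : ℂ) r, eval (L t) (f k) ≠ 0 := fun t ht =>
    hfk.ne_zero (hin t ht) hk1'
  have hLd : Differentiable ℂ L := by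
    rw [differentiable_pi]; intro i; fun_prop
  have hd : DifferentiableOn ℂ (fun t => (eval (L t) (f k))⁻¹) (Metric.closedBall 0 r) :=
    (((differentiable_eval (f k)).comp hLd).differentiableOn).fun_inv hnz
  have hclos : closure (Metric.ball (0 : ℂ) r) = Metric.closedBall 0 r :=
    closure_ball _ hr0.ne'
  have hmaxp := Complex.norm_le_of_forall_mem_frontier_norm_le (C := 2 / m)
    (U := Metric.ball (0 : ℂ) r) (f := fun t => (eval (L t) (f k))⁻¹) (z := 0)
    Metric.isBounded_ball (DifferentiableOn.diffContOnCl (by rwa [hclos])) (fun t ht => by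
      rw [frontier_ball _ hr0.ne'] at ht
      have h1 := hk (L t) ⟨t, Metric.sphere_subset_closedBall ht, rfl⟩
      have h2 : m ≤ ‖eval (L t) g‖ := hmin ht
      rw [dist_eq_norm] at h1
      have h3 : ‖eval (L t) g‖ ≤ ‖eval (L t) g - eval (L t) (f k)‖ + ‖eval (L t) (f k)‖ := by
        simpa using norm_add_le (eval (L t) g - eval (L t) (f k)) (eval (L t) (f k))
      rw [norm_inv, inv_le_comm₀ (by linarith) (by positivity), inv_div]
      linarith) (subset_closure (by simpa using hr0))
  have h4 := hk (L 0) ⟨0, by simpa using hr0.le, rfl⟩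
  have h5 := hnz 0 (by simpa using hr0.le)
  rw [hL0] at h4 h5
  rw [hL0, norm_inv, inv_le_comm₀ (norm_pos_iff.2 h5) (by positivity), inv_div] at hmaxp
  rw [hgz₀, dist_zero_left] at h4
  linarith

lemma stableOrZero_of_tendsto_sum [Fintype σ] {ι : Type*} (s : Finset ι) {c : ℕ → ι → ℂ}
    {c₀ : ι → ℂ} (hc : ∀ i ∈ s, Tendsto (fun k => c k i) atTop (𝓝 (c₀ i)))
    (g : ι → MvPolynomial σ ℂ)
    (hf : ∀ᶠ k in atTop, StableOrZero (∑ i ∈ s, c k i • g i)) :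
    StableOrZero (∑ i ∈ s, c₀ i • g i) := by
  refine stableOrZero_of_tendsto hf fun K hK => ?_
  simp only [map_sum, smul_eval]
  clear hf
  rw [Metric.tendstoUniformlyOn_iff]
  intro ε hε
  have hb : ∀ i, ∃ M, 0 < M ∧ ∀ z ∈ K, ‖eval z (g i)‖ ≤ M := fun i => by
    obtain ⟨M, hM⟩ := hK.exists_bound_of_continuousOn
      (differentiable_eval (g i)).continuous.continuousOn
    exact ⟨max M 1, by positivity, fun z hz => (hM z hz).trans (le_max_left _ _)⟩
  choose M hM0 hM using hb
  have ht : Tendsto (fun k => ∑ i ∈ s, ‖c₀ i - c k i‖ * M i) atTop (𝓝 0) := by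
    have : Tendsto (fun k => ∑ i ∈ s, ‖c₀ i - c k i‖ * M i) atTop (𝓝 (∑ i ∈ s, 0)) := by
      refine tendsto_finsetSum _ fun i hi => ?_
      have h1 := ((tendsto_const_nhds (x := c₀ i)).sub (hc i hi)).norm
      simpa using h1.mul_const (M i)
    simpa using this
  filter_upwards [ht.eventually_lt_const hε] with k hk z hz
  rw [dist_eq_norm, ← Finset.sum_sub_distrib]
  refine lt_of_le_of_lt (norm_sum_le _ _) (lt_of_le_of_lt (Finset.sum_le_sum fun i hi => ?_) hk)
  rw [← sub_mul, norm_mul]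
  exact mul_le_mul_of_nonneg_left (hM i z hz) (norm_nonneg _)

lemma stableOrZero_of_tendsto_add [Fintype σ] {c : ℕ → ℂ} (hc : Tendsto c atTop (𝓝 0))
    (f g : MvPolynomial σ ℂ) (h : ∀ᶠ k in atTop, StableOrZero (f + c k • g)) :
    StableOrZero f := by
  have := stableOrZero_of_tendsto_sum (σ := σ) (Finset.univ : Finset (Fin 2))
    (c := fun k => ![1, c k]) (c₀ := ![1, 0]) (by
      intro i _
      fin_cases i
      · simp
      · simpa using hc) ![f, g] (by simpa using h)
  simpa using this

end Hurwitz

section LiebSokal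

variable {σ : Type*}

lemma im_pderiv_div_le {f : MvPolynomial σ ℂ} (hf : IsStable f) (a : σ) {z : σ → ℂ}
    (hz : z ∈ upperHalf σ) : (eval z (pderiv a f) / eval z f).im ≤ 0 := by
  classical
  set x : σ → ℂ := Function.update z a 0
  set y : σ → ℂ := Pi.single a 1
  have hxy : ∀ t : ℂ, (fun i => x i + y i * t) = Function.update z a t := fun t => by
    ext i
    by_cases hi : i = a
    · subst hi; simp [x, y]
    · simp [x, y, hi]
  have hder : ∀ p : MvPolynomial σ ℂ,
      (lineRestrict x y p).derivative = lineRestrict x y (pderiv a p) := by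
    intro p
    unfold lineRestrict
    induction p using MvPolynomial.induction_on with
    | C a => simp
    | add p q hp hq => simp [hp, hq]
    | mul_X p i hp =>
      simp only [map_mul, aeval_X, Polynomial.derivative_mul, hp, Derivation.leibniz, smul_eq_mul,
        map_add, pderiv_X, Polynomial.derivative_C, Polynomial.derivative_X]
      by_cases hi : i = a
      · subst hi
        simp [y]; ring
      · simp [y, hi]; ring
  have h := im_derivative_mul_conj_le (q := lineRestrict x y f) (t := z a)
    (fun t ht => by
      rw [eval_lineRestrict, hxy]
      refine hf _ fun i => ?_
      by_cases hi : i = a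
      · subst hi; simpa using ht
      · simpa [hi] using hz i) (hz a)
  rw [hder, eval_lineRestrict, eval_lineRestrict, hxy, Function.update_eq_self] at h
  exact h

lemma IsStable.smul {f : MvPolynomial σ ℂ} (hf : IsStable f) {c : ℂ} (hc : c ≠ 0) :
    IsStable (c • f) := fun z hz => by
  rw [smul_eval]
  exact mul_ne_zero hc (hf z hz)

lemma StableOrZero.smul {f : MvPolynomial σ ℂ} (hf : StableOrZero f) (c : ℂ) :
    StableOrZero (c • f) := by
  by_cases hc : c = 0
  · right; simp [hc]
  rcases hf with hf | rfl
  · exact Or.inl (IsStable.smul hf hc)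
  · right; simp

lemma isStable_add_smul_pderiv {f : MvPolynomial σ ℂ} (hf : IsStable f) (a : σ) {s : ℂ}
    (hs : 0 < s.im) : IsStable (f + s • pderiv a f) := by
  intro z hz h0
  have h1 := im_pderiv_div_le hf a hz
  have hf0 := hf z hz
  have hs0 : s ≠ 0 := by rintro rfl; simp at hs
  have h2 : eval z (pderiv a f) / eval z f = - s⁻¹ := by
    simp only [map_add, smul_eval] at h0
    field_simp
    linear_combination h0
  rw [h2, Complex.neg_im, Complex.inv_im] at h1
  have : 0 < s.im / Complex.normSq s := div_pos hs (Complex.normSq_pos.2 hs0)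
  simp only [neg_div, neg_neg] at h1
  linarith

lemma stableOrZero_pderiv [Fintype σ] {f : MvPolynomial σ ℂ} (hf : IsStable f) (a : σ) :
    StableOrZero (pderiv a f) := by
  refine stableOrZero_of_tendsto_add (c := fun k : ℕ => -Complex.I * (1 / ((k : ℂ) + 1))) ?_ _ f ?_
  · simpa using (tendsto_one_div_add_atTop_nhds_zero_nat (𝕜 := ℂ)).const_mul (-Complex.I)
  · refine Eventually.of_forall fun k => Or.inl ?_
    have hk : (k : ℂ) + 1 ≠ 0 := Nat.cast_add_one_ne_zero k
    have h := IsStable.smul (isStable_add_smul_pderiv hf a (s := ((k : ℂ) + 1) * Complex.I)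
      (by simp; positivity)) (c := -Complex.I * (1 / ((k : ℂ) + 1))) (by simp [hk])
    convert h using 1
    rw [smul_add, smul_smul, add_comm]
    congr 1
    have : -Complex.I * (1 / ((k : ℂ) + 1)) * (((k : ℂ) + 1) * Complex.I) = 1 := by
      field_simp
      simp
    rw [this, one_smul]

/-- The operator `1 - ε ∂ₐ ∂_b` with `ε ≥ 0` preserves stability. -/
lemma stableOrZero_sub_pderiv_pderiv [Fintype σ] {f : MvPolynomial σ ℂ} (hf : StableOrZero f)
    (a b : σ) {ε : ℝ} (hε : 0 ≤ ε) :
    StableOrZero (f - (ε : ℂ) • pderiv a (pderiv b f)) := by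
  rcases hf with hf | rfl
  swap
  · right; simp
  rcases stableOrZero_pderiv hf b with hQ | hQ
  swap
  · left; simpa [hQ] using hf
  refine stableOrZero_of_tendsto_add (c := fun k : ℕ => Complex.I * (1 / ((k : ℂ) + 1))) ?_ _
    (pderiv b f) ?_
  · simpa using (tendsto_one_div_add_atTop_nhds_zero_nat (𝕜 := ℂ)).const_mul Complex.I
  · refine Eventually.of_forall fun k => Or.inl fun z hz h0 => ?_
    have h1 := im_pderiv_div_le hf b hz
    have h2 := im_pderiv_div_le hQ a hz
    have hf0 := hf z hz
    have hQ0 := hQ z hz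
    set F := eval z f
    set Q := eval z (pderiv b f) with hQd
    set R := eval z (pderiv a (pderiv b f)) with hR
    have h3 : F / Q + Complex.I * (1 / ((k : ℂ) + 1)) - ε * (R / Q) = 0 := by
      simp only [map_add, map_sub, smul_eval, ← hQd, ← hR] at h0
      field_simp
      have hk : (k : ℂ) + 1 ≠ 0 := Nat.cast_add_one_ne_zero k
      field_simp at h0
      linear_combination h0
    have h4 : 0 ≤ (F / Q).im := by
      rw [← inv_div, Complex.inv_im]
      exact div_nonneg (by linarith) (Complex.normSq_nonneg _)
    have h5 := congrArg Complex.im h3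
    have h6 : (Complex.I * (1 / ((k : ℂ) + 1))).im = 1 / ((k : ℝ) + 1) := by
      have : (1 : ℂ) / ((k : ℂ) + 1) = ((1 / ((k : ℝ) + 1) : ℝ) : ℂ) := by push_cast; rfl
      rw [this, mul_comm, Complex.im_ofReal_mul, Complex.I_im, mul_one]
    rw [Complex.sub_im, Complex.add_im, h6, Complex.im_ofReal_mul] at h5
    have h7 : 0 < 1 / ((k : ℝ) + 1) := by positivity
    have h8 : ε * (R / Q).im ≤ 0 := mul_nonpos_of_nonneg_of_nonpos hε h2
    simp only [Complex.zero_im] at h5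
    linarith

end LiebSokal

section Contraction

variable {σ : Type*}

lemma stableOrZero_of_continuous [Fintype σ] {F : ℂ → MvPolynomial σ ℂ}
    (hF : Continuous fun p : ℂ × (σ → ℂ) => eval p.2 (F p.1)) {c : ℕ → ℂ} {c₀ : ℂ}
    (hc : Tendsto c atTop (𝓝 c₀)) (h : ∀ᶠ k in atTop, StableOrZero (F (c k))) :
    StableOrZero (F c₀) := by
  refine stableOrZero_of_tendsto h ?_
  have h1 := (((ContinuousMap.curry ⟨_, hF⟩).continuous.tendsto c₀).comp hc)
  rw [ContinuousMap.tendsto_iff_forall_isCompact_tendstoUniformlyOn] at h1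
  exact h1

open Classical in
/-- Substitution of a constant for the two variables `a` and `b`. -/
noncomputable def substPair (a b : σ) (s : ℂ) : MvPolynomial σ ℂ →ₐ[ℂ] MvPolynomial σ ℂ :=
  aeval fun x => if x = a ∨ x = b then C s else X x

open Classical in
lemma eval_substPair (a b : σ) (s : ℂ) (f : MvPolynomial σ ℂ) (z : σ → ℂ) :
    eval z (substPair a b s f) = eval (fun x => if x = a ∨ x = b then s else z x) f := by
  unfold substPair
  induction f using MvPolynomial.induction_on with
  | C a => simp
  | add p q hp hq => simp only [map_add, hp, hq]
  | mul_X p i hp =>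
    simp only [map_mul, aeval_X, hp, eval_X]
    split_ifs <;> simp

lemma stableOrZero_substPair [Fintype σ] {f : MvPolynomial σ ℂ} (hf : StableOrZero f) (a b : σ) :
    StableOrZero (substPair a b 0 f) := by
  classical
  rcases hf with hf | rfl
  swap
  · right; simp
  refine stableOrZero_of_continuous (F := fun s => substPair a b s f)
    (c := fun k : ℕ => Complex.I * (1 / ((k : ℂ) + 1))) ?_ ?_ ?_
  · simp only [eval_substPair]
    refine (differentiable_eval f).continuous.comp (continuous_pi fun x => ?_)
    split_ifs <;> fun_prop
  · simpa using (tendsto_one_div_add_atTop_nhds_zero_nat (𝕜 := ℂ)).const_mul Complex.I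
  · refine Eventually.of_forall fun k => Or.inl fun z hz => ?_
    rw [eval_substPair]
    refine hf _ fun i => ?_
    split_ifs
    · have : (1 : ℂ) / ((k : ℂ) + 1) = ((1 / ((k : ℝ) + 1) : ℝ) : ℂ) := by push_cast; rfl
      rw [this, mul_comm, Complex.im_ofReal_mul, Complex.I_im, mul_one]
      positivity
    · exact hz i

lemma substPair_monomial (a b : σ) (m : σ →₀ ℕ) (c : ℂ) :
    substPair a b 0 (monomial m c) = if m a = 0 ∧ m b = 0 then monomial m c else 0 := by
  classical
  unfold substPair
  rw [aeval_monomial]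
  split_ifs with h
  · rw [monomial_eq]
    congr 1
    refine Finsupp.prod_congr fun x hx => ?_
    have : ¬ (x = a ∨ x = b) := by
      rintro (rfl | rfl)
      · simp [h.1] at hx
      · simp [h.2] at hx
    simp [this]
  · rw [not_and_or] at h
    have : ∃ x, (x = a ∨ x = b) ∧ m x ≠ 0 := by
      rcases h with h | h
      · exact ⟨a, Or.inl rfl, h⟩
      · exact ⟨b, Or.inr rfl, h⟩
    obtain ⟨x, hx, hmx⟩ := this
    rw [Finsupp.prod, Finset.prod_eq_zero (i := x) (by simpa using hmx), mul_zero]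
    simp [hx, hmx]

/-- The linear operator `∂ₐ ∂_b`. -/
noncomputable def pderivPair (a b : σ) : Module.End ℂ (MvPolynomial σ ℂ) :=
  (pderiv a).toLinearMap ∘ₗ (pderiv b).toLinearMap

lemma pderivPair_pow_monomial {a b : σ} (hab : a ≠ b) (i : ℕ) (m : σ →₀ ℕ) (c : ℂ) :
    (pderivPair a b ^ i) (monomial m c) =
      monomial (m - i • (Finsupp.single a 1 + Finsupp.single b 1))
        (c * ((m a).descFactorial i * (m b).descFactorial i)) := by
  induction i with
  | zero => simp
  | succ i ih =>
    rw [pow_succ', Module.End.mul_apply, ih]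
    simp only [pderivPair, LinearMap.comp_apply, Derivation.coeFn_coe, pderiv_monomial]
    have he : m - i • (Finsupp.single a 1 + Finsupp.single b 1) - Finsupp.single b 1 -
        Finsupp.single a 1 = m - (i + 1) • (Finsupp.single a 1 + Finsupp.single b 1) := by
      ext x
      simp only [Finsupp.tsub_apply, Finsupp.smul_apply, Finsupp.add_apply, smul_eq_mul,
        add_mul, one_mul]
      omega
    rw [he]
    congr 1
    · simp [hab, hab.symm, Nat.descFactorial_succ]
      ring

/-- The multiplier of the `N`-th approximate contraction of a pair of variables. -/
noncomputable def contractCoeff (N i j : ℕ) : ℂ :=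
  if i = j then (-1) ^ i * (N.choose i) * (i.factorial) ^ 2 * (1 / (N : ℂ)) ^ i else 0

lemma exists_contraction_pair [Fintype σ] {a b : σ} (hab : a ≠ b) (N : ℕ) :
    ∃ R : MvPolynomial σ ℂ →ₗ[ℂ] MvPolynomial σ ℂ,
      (∀ f, StableOrZero f → StableOrZero (R f)) ∧
      ∀ m c, R (monomial m c) =
        monomial ((m.erase a).erase b) (c * contractCoeff N (m a) (m b)) := by
  classical
  set x : Module.End ℂ (MvPolynomial σ ℂ) := (-(1 / (N : ℂ))) • pderivPair a b with hx
  refine ⟨(substPair a b 0).toLinearMap ∘ₗ (x + 1) ^ N, fun f hf => ?_, fun m c => ?_⟩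
  · refine stableOrZero_substPair ?_ a b
    have hstep : ∀ k : ℕ, StableOrZero (((x + 1) ^ k) f) := by
      intro k
      induction k with
      | zero => simpa using hf
      | succ k ih =>
        rw [pow_succ', Module.End.mul_apply]
        have := stableOrZero_sub_pderiv_pderiv ih a b (ε := 1 / (N : ℝ)) (by positivity)
        convert this using 1
        simp [hx, pderivPair]
        ring
    exact hstep N
  · have hpow : (x + 1) ^ N = ∑ i ∈ Finset.range (N + 1),
        ((-(1 / (N : ℂ))) ^ i * (N.choose i : ℂ)) • pderivPair a b ^ i := by
      rw [(Commute.one_right x).add_pow]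
      refine Finset.sum_congr rfl fun i _ => ?_
      rw [one_pow, mul_one, hx, smul_pow, mul_smul, ← nsmul_eq_mul', Nat.cast_smul_eq_nsmul]
      rw [smul_comm]
    rw [LinearMap.comp_apply, hpow, LinearMap.sum_apply, map_sum]
    simp only [LinearMap.smul_apply, map_smul, pderivPair_pow_monomial hab,
      AlgHom.toLinearMap_apply, substPair_monomial]
    have key : ∀ i ∈ Finset.range (N + 1), i ≠ m a →
        ((-(1 / (N : ℂ))) ^ i * (N.choose i : ℂ)) •
        (if (m - i • (Finsupp.single a 1 + Finsupp.single b 1) : σ →₀ ℕ) a = 0 ∧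
          (m - i • (Finsupp.single a 1 + Finsupp.single b 1) : σ →₀ ℕ) b = 0 then
          monomial (m - i • (Finsupp.single a 1 + Finsupp.single b 1))
          (c * (((m a).descFactorial i : ℂ) * ((m b).descFactorial i : ℂ))) else 0) = 0 := by
      intro i _ hi
      split_ifs with h
      · have h1 : m a < i := by
          have := h.1
          simp [hab] at this
          omega
        rw [Nat.descFactorial_eq_zero_iff_lt.2 h1]
        simp
      · simp
    by_cases hN : m a ≤ N
    · rw [Finset.sum_eq_single_of_mem (m a) (by simpa using Nat.lt_succ_of_le hN) key]
      by_cases hmm : m a = m b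
      · have hc : (m - m a • (Finsupp.single a 1 + Finsupp.single b 1) : σ →₀ ℕ) a = 0 ∧
          (m - m a • (Finsupp.single a 1 + Finsupp.single b 1) : σ →₀ ℕ) b = 0 := by
          simp [hab, hab.symm, hmm]
        rw [if_pos hc, smul_monomial]
        have he : m - m a • (Finsupp.single a 1 + Finsupp.single b 1) =
            (m.erase a).erase b := by
          ext y
          by_cases hya : y = a
          · subst hya; simp [hab]
          · by_cases hyb : y = b
            · subst hyb; simp [hab.symm, hmm]
            · simp [Finsupp.erase_ne, hya, hyb]
        rw [he]
        congr 1
        · rw [contractCoeff, if_pos hmm, ← hmm, Nat.descFactorial_self]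
          rw [neg_pow (1 / (N : ℂ))]
          simp only [smul_eq_mul]
          ring
      · rw [contractCoeff, if_neg hmm, mul_zero, monomial_zero]
        split_ifs with h
        · have h2 : m b < m a := by
            have := h.2
            simp [hab.symm] at this
            omega
          rw [Nat.descFactorial_eq_zero_iff_lt.2 h2]
          simp
        · simp
    · rw [Finset.sum_eq_zero fun i hi => key i hi (by rintro rfl; simp at hi; omega)]
      rw [contractCoeff, Nat.choose_eq_zero_of_lt (by omega)]
      simp

open Classical in
/-- Simultaneous contraction of the pairs of variables `(a j, b j)`. -/
lemma exists_contraction [Fintype σ] {ι : Type*} {a b : ι → σ} (ha : Function.Injective a)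
    (hb : Function.Injective b) (hab : ∀ i j, a i ≠ b j) (N : ℕ) (s : Finset ι) :
    ∃ R : MvPolynomial σ ℂ →ₗ[ℂ] MvPolynomial σ ℂ,
      (∀ f, StableOrZero f → StableOrZero (R f)) ∧
      ∀ m c, ∃ m' : σ →₀ ℕ, (∀ x, m' x = if ∃ j ∈ s, x = a j ∨ x = b j then 0 else m x) ∧
        R (monomial m c) = monomial m' (c * ∏ j ∈ s, contractCoeff N (m (a j)) (m (b j))) := by
  induction s using Finset.induction_on with
  | empty => exact ⟨LinearMap.id, fun f hf => hf, fun m c => ⟨m, by simp, by simp⟩⟩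
  | insert j s hj ih =>
    obtain ⟨R, hR, hRm⟩ := ih
    obtain ⟨R', hR', hRm'⟩ := exists_contraction_pair (hab j j) N
    refine ⟨R' ∘ₗ R, fun f hf => hR' _ (hR f hf), fun m c => ?_⟩
    obtain ⟨m', hm', hRmm⟩ := hRm m c
    refine ⟨(m'.erase (a j)).erase (b j), fun x => ?_, ?_⟩
    · by_cases hxa : x = a j
      · subst hxa
        simp [Finsupp.erase_ne (hab j j)]
      · by_cases hxb : x = b j
        · subst hxb; simp
        · rw [Finsupp.erase_ne hxb, Finsupp.erase_ne hxa, hm']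
          simp [hxa, hxb]
    · rw [LinearMap.comp_apply, hRmm, hRm', Finset.prod_insert hj]
      have h1 : m' (a j) = m (a j) := by
        rw [hm', if_neg]
        rintro ⟨i, hi, h | h⟩
        · exact hj (ha h ▸ hi)
        · exact hab _ _ h
      have h2 : m' (b j) = m (b j) := by
        rw [hm', if_neg]
        rintro ⟨i, hi, h | h⟩
        · exact hab _ _ h.symm
        · exact hj (hb h ▸ hi)
      rw [h1, h2]
      congr 1
      ring

end Contraction

section TorusBound

/-- Cauchy's estimate for the coefficients of a polynomial on a torus. -/
lemma norm_coeff_mul_pow_le {σ : Type*} [Fintype σ] (h : MvPolynomial σ ℂ) {R ε : ℝ}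
    (hR : 0 < R) (hh : ∀ w : σ → ℂ, (∀ i, ‖w i‖ = R) → ‖eval w h‖ ≤ ε) (α : σ →₀ ℕ) :
    ‖coeff α h‖ * R ^ α.degree ≤ ε := by
  classical
  set N := max h.totalDegree α.degree + 1 with hN
  have hN0 : N ≠ 0 := by omega
  set ζ := Complex.exp (2 * Real.pi * Complex.I / N) with hζ
  have hprim : IsPrimitiveRoot ζ N := Complex.isPrimitiveRoot_exp N hN0
  have hζ0 : ζ ≠ 0 := Complex.exp_ne_zero _
  have hζ1 : ‖ζ‖ = 1 := hprim.norm'_eq_one hN0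
  have hle : ∀ (γ : σ →₀ ℕ) (i : σ), γ i ≤ γ.degree := fun γ i => Finsupp.le_degree i γ
  have hgeom : ∀ a b : ℕ, a < N → b < N →
      ∑ j ∈ Finset.range N, (ζ ^ j) ^ a * ((ζ⁻¹) ^ j) ^ b = if a = b then (N : ℂ) else 0 := by
    intro a b ha hb
    have e : ∀ j, (ζ ^ j) ^ a * ((ζ⁻¹) ^ j) ^ b = (ζ ^ a * (ζ⁻¹) ^ b) ^ j := fun j => by
      rw [mul_pow, ← pow_mul, ← pow_mul, ← pow_mul, ← pow_mul, mul_comm j a, mul_comm j b]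
    simp only [e]
    split_ifs with hab
    · subst hab
      simp [hζ0]
    · have hx : ζ ^ a * (ζ⁻¹) ^ b ≠ 1 := by
        intro h1
        rw [inv_pow, mul_inv_eq_one₀ (pow_ne_zero _ hζ0)] at h1
        exact hab (hprim.pow_inj ha hb h1)
      rw [geom_sum_eq hx, mul_pow, ← pow_mul, ← pow_mul, mul_comm a, mul_comm b, pow_mul,
        pow_mul, inv_pow, hprim.pow_eq_one]
      simp
  set J : Finset (σ → ℕ) := Fintype.piFinset fun _ => Finset.range N with hJ
  have hsum : ∑ j ∈ J, eval (fun i => (R : ℂ) * ζ ^ j i) h * ∏ i, ((ζ⁻¹) ^ j i) ^ α i =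
      (N : ℂ) ^ Fintype.card σ * (coeff α h * (R : ℂ) ^ α.degree) := by
    have e1 : ∀ j : σ → ℕ, eval (fun i => (R : ℂ) * ζ ^ j i) h * ∏ i, ((ζ⁻¹) ^ j i) ^ α i =
        ∑ γ ∈ h.support, coeff γ h * (R : ℂ) ^ γ.degree *
          ∏ i, ((ζ ^ j i) ^ γ i * ((ζ⁻¹) ^ j i) ^ α i) := fun j => by
      rw [eval_eq', Finset.sum_mul]
      refine Finset.sum_congr rfl fun γ _ => ?_
      simp only [mul_pow, Finset.prod_mul_distrib, Finset.prod_pow_eq_pow_sum,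
        Finsupp.degree_eq_sum]
      ring
    simp only [e1]
    rw [Finset.sum_comm]
    simp only [← Finset.mul_sum]
    have e2 : ∀ γ ∈ h.support, ∑ j ∈ J, ∏ i, ((ζ ^ j i) ^ γ i * ((ζ⁻¹) ^ j i) ^ α i) =
        if γ = α then (N : ℂ) ^ Fintype.card σ else 0 := fun γ hγ => by
      rw [hJ, Finset.sum_prod_piFinset (Finset.range N)
        (fun i k => (ζ ^ k) ^ γ i * ((ζ⁻¹) ^ k) ^ α i)]
      have hγN : ∀ i, γ i < N := fun i => by
        have h1 := hle γ i
        have h2 := le_totalDegree hγ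
        have h3 : (γ.sum fun _ e => e) = γ.degree := rfl
        omega
      have hαN : ∀ i, α i < N := fun i => by
        have h1 := hle α i
        omega
      simp only [hgeom _ _ (hγN _) (hαN _)]
      split_ifs with hγα
      · subst hγα; simp
      · obtain ⟨i, hi⟩ : ∃ i, γ i ≠ α i := by
          by_contra! hcon
          exact hγα (Finsupp.ext hcon)
        exact Finset.prod_eq_zero (Finset.mem_univ i) (by simp [hi])
    rw [Finset.sum_congr rfl fun γ hγ => by rw [e2 γ hγ]]
    simp only [mul_ite, mul_zero, Finset.sum_ite_eq']
    split_ifs with hα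
    · ring
    · simp [notMem_support_iff.1 hα]
  have hbound : ‖(N : ℂ) ^ Fintype.card σ * (coeff α h * (R : ℂ) ^ α.degree)‖ ≤
      (N : ℝ) ^ Fintype.card σ * ε := by
    rw [← hsum]
    refine (norm_sum_le _ _).trans ?_
    have : ∀ j ∈ J, ‖eval (fun i => (R : ℂ) * ζ ^ j i) h * ∏ i, ((ζ⁻¹) ^ j i) ^ α i‖ ≤ ε := by
      intro j _
      rw [norm_mul, norm_prod]
      simp only [norm_pow, norm_inv, hζ1, inv_one, one_pow, Finset.prod_const_one, mul_one]
      exact hh _ fun i => by simp [hζ1, abs_of_pos hR]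
    refine (Finset.sum_le_card_nsmul _ _ _ this).trans ?_
    simp [hJ]
  rw [norm_mul, norm_mul, norm_pow, norm_pow, Complex.norm_natCast, Complex.norm_real,
    Real.norm_of_nonneg hR.le] at hbound
  exact le_of_mul_le_mul_left hbound (by positivity)

end TorusBound

section Szasz

open Polynomial in
lemma univariate_norm_coeff_mul_pow_le (q : ℂ[X]) {R M : ℝ} (hR : 0 < R)
    (hq : ∀ t : ℂ, ‖t‖ = R → ‖q.eval t‖ ≤ M) (d : ℕ) : ‖q.coeff d‖ * R ^ d ≤ M := by
  have h := norm_coeff_mul_pow_le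
    (∑ i ∈ q.support, MvPolynomial.monomial (Finsupp.single () i) (q.coeff i)) hR
    (ε := M) (fun w hw => by
      rw [map_sum]
      simp only [MvPolynomial.eval_monomial, Finsupp.prod_single_index, pow_zero]
      have := hq (w ()) (hw ())
      rwa [Polynomial.eval_eq_sum, Polynomial.sum] at this) (Finsupp.single () d)
  have e : MvPolynomial.coeff (Finsupp.single () d)
      (∑ i ∈ q.support, MvPolynomial.monomial (Finsupp.single () i) (q.coeff i)) =
      q.coeff d := by
    rw [MvPolynomial.coeff_sum]
    simp only [MvPolynomial.coeff_monomial, (Finsupp.single_injective ()).eq_iff]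
    simp only [Finset.sum_ite_eq', Polynomial.mem_support_iff, ite_not]
    split_ifs with h0
    exacts [h0.symm, rfl]
  rwa [e, Finsupp.degree_single] at h

/-- Majorant in Szász's inequality. -/
noncomputable def szaszBound (R : ℝ) (a b c : ℂ) : ℝ :=
  ‖a‖ * Real.exp (R * ‖b / a‖ + R ^ 2 / 2 * (‖(b / a) ^ 2 - 2 * (c / a)‖ + 2 * ‖b / a‖ ^ 2))

open Polynomial in
lemma coeff_prod_one_add (s : Multiset ℂ) :
    (s.map fun a => 1 + Polynomial.C a * Polynomial.X).prod.coeff 0 = 1 ∧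
    (s.map fun a => 1 + Polynomial.C a * Polynomial.X).prod.coeff 1 = s.sum ∧
    s.sum ^ 2 - 2 * (s.map fun a => 1 + Polynomial.C a * Polynomial.X).prod.coeff 2 =
      (s.map fun a => a ^ 2).sum := by
  induction s using Multiset.induction_on with
  | empty => simp [Polynomial.coeff_one]
  | cons a s ih =>
    obtain ⟨h0, h1, h2⟩ := ih
    simp only [Multiset.map_cons, Multiset.prod_cons, Multiset.sum_cons, add_mul, one_mul,
      mul_assoc, Polynomial.coeff_add, Polynomial.coeff_C_mul, Polynomial.coeff_X_mul_zero,
      Polynomial.coeff_X_mul, h0, h1]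
    refine ⟨by simp, by ring, ?_⟩
    rw [← h2]
    ring

open Polynomial in
lemma norm_eval_prod_one_add_le (s : Multiset ℂ) (hs : ∀ a ∈ s, a.im ≤ 0) (t : ℂ) :
    ‖(s.map fun a => 1 + Polynomial.C a * Polynomial.X).prod.eval t‖ ≤
      Real.exp (‖t‖ * ‖s.sum‖ +
        ‖t‖ ^ 2 / 2 * (‖(s.map fun a => a ^ 2).sum‖ + 2 * ‖s.sum‖ ^ 2)) := by
  have h1 : ‖(s.map fun a => 1 + Polynomial.C a * Polynomial.X).prod.eval t‖ ^ 2 ≤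
      Real.exp (2 * (t * s.sum).re + ‖t‖ ^ 2 * (s.map fun a => ‖a‖ ^ 2).sum) := by
    clear hs
    induction s using Multiset.induction_on with
    | empty => simp
    | cons a s ih =>
      simp only [Multiset.map_cons, Multiset.prod_cons, Multiset.sum_cons, Polynomial.eval_mul,
        norm_mul, mul_pow]
      have e : 2 * (t * (a + s.sum)).re + ‖t‖ ^ 2 * (‖a‖ ^ 2 + (s.map fun a => ‖a‖ ^ 2).sum) =
        (2 * (t * a).re + ‖t * a‖ ^ 2) +
          (2 * (t * s.sum).re + ‖t‖ ^ 2 * (s.map fun a => ‖a‖ ^ 2).sum) := by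
        rw [mul_add, Complex.add_re, norm_mul]; ring
      rw [e, Real.exp_add]
      refine mul_le_mul ?_ ih (by positivity) (by positivity)
      refine le_trans (le_of_eq ?_) (Real.add_one_le_exp _)
      simp only [Polynomial.eval_add, Polynomial.eval_one, Polynomial.eval_mul,
        Polynomial.eval_C, Polynomial.eval_X]
      rw [mul_comm a t, Complex.sq_norm, Complex.sq_norm, Complex.normSq_apply,
        Complex.normSq_apply]
      simp only [Complex.add_re, Complex.add_im, Complex.one_re, Complex.one_im]
      ring
  have h2 : (s.map fun a => ‖a‖ ^ 2).sum =
      (s.map fun a => a ^ 2).sum.re + 2 * (s.map fun a => a.im ^ 2).sum := by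
    clear h1 hs
    induction s using Multiset.induction_on with
    | empty => simp
    | cons a s ih =>
      simp only [Multiset.map_cons, Multiset.sum_cons, ih, Complex.add_re]
      rw [Complex.sq_norm, Complex.normSq_apply, sq a, Complex.mul_re]
      ring
  have h3 : s.sum.im ≤ 0 ∧ (s.map fun a => a.im ^ 2).sum ≤ s.sum.im ^ 2 := by
    clear h1 h2
    induction s using Multiset.induction_on with
    | empty => simp
    | cons a s ih =>
      obtain ⟨i1, i2⟩ := ih fun b hb => hs b (by simp [hb])
      have ha := hs a (by simp)
      simp only [Multiset.map_cons, Multiset.sum_cons, Complex.add_im]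
      refine ⟨by linarith, ?_⟩
      nlinarith [mul_nonneg (neg_nonneg.2 ha) (neg_nonneg.2 i1)]
  set S := s.sum
  set Q := (s.map fun a => a ^ 2).sum
  refine abs_le_of_sq_le_sq' ?_ (Real.exp_pos _).le |>.2
  refine h1.trans ?_
  rw [← Real.exp_nat_mul]
  refine Real.exp_le_exp.2 ?_
  have h4 : (t * S).re ≤ ‖t‖ * ‖S‖ := (Complex.re_le_norm _).trans (norm_mul_le _ _)
  have h5 : S.im ^ 2 ≤ ‖S‖ ^ 2 := by
    rw [Complex.sq_norm, Complex.normSq_apply]; nlinarith [sq_nonneg S.re]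
  have h6 : Q.re ≤ ‖Q‖ := Complex.re_le_norm _
  have h7 : (s.map fun a => ‖a‖ ^ 2).sum ≤ ‖Q‖ + 2 * ‖S‖ ^ 2 := by linarith [h3.2]
  have h8 := mul_le_mul_of_nonneg_left h7 (sq_nonneg ‖t‖)
  push_cast
  linarith

open Polynomial in
/-- Szász's inequality: the coefficients of a univariate stable polynomial are controlled by its
three lowest ones. -/
lemma szasz {q : ℂ[X]} (hq : ∀ t : ℂ, 0 < t.im → q.eval t ≠ 0) {s : ℕ}
    (hs : ∀ i < s, q.coeff i = 0) (hs0 : q.coeff s ≠ 0) {R : ℝ} (hR : 0 < R) (d : ℕ) :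
    ‖q.coeff d‖ * R ^ d ≤ R ^ s * szaszBound R (q.coeff s) (q.coeff (s + 1)) (q.coeff (s + 2)) := by
  obtain ⟨g, rfl⟩ := Polynomial.X_pow_dvd_iff.2 hs
  have hg : ∀ i, (Polynomial.X ^ s * g).coeff (s + i) = g.coeff i := fun i => by
    rw [add_comm, Polynomial.coeff_X_pow_mul]
  have hg0 := hg 0
  rw [add_zero] at hg0
  rw [hg0] at hs0 ⊢
  rw [hg, hg]
  have hgq : ∀ t : ℂ, 0 < t.im → g.eval t ≠ 0 := fun t ht h => hq t ht (by simp [h])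
  obtain ⟨r, hr, hlc, hfac⟩ := exists_multiset_of_ne_zero hgq
  have hr0 : ∀ a ∈ r, a ≠ 0 := by
    rintro a ha rfl
    apply hs0
    rw [coeff_zero_eq_eval_zero, hfac]
    obtain ⟨r', rfl⟩ := Multiset.exists_cons_of_mem ha
    simp
  obtain ⟨c, u, hc, hu, hgu⟩ : ∃ (c : ℂ) (u : Multiset ℂ), c ≠ 0 ∧ (∀ a ∈ u, a.im ≤ 0) ∧
      g = Polynomial.C c * (u.map fun a => 1 + Polynomial.C a * Polynomial.X).prod := by
    refine ⟨g.leadingCoeff * (r.map fun a => -a).prod, r.map fun a => -a⁻¹, ?_, ?_, ?_⟩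
    · refine mul_ne_zero hlc (Multiset.prod_ne_zero ?_)
      simpa using fun h => hr0 0 h rfl
    · simp only [Multiset.mem_map, forall_exists_index, and_imp, forall_apply_eq_imp_iff₂]
      intro a ha
      have := hr a ha
      rw [Complex.neg_im, Complex.inv_im, neg_div, neg_neg]
      exact div_nonpos_of_nonpos_of_nonneg this (Complex.normSq_nonneg _)
    · conv_lhs => rw [hfac]
      rw [Polynomial.C_mul, mul_assoc]
      congr 1
      clear hfac hr
      induction r using Multiset.induction_on with
      | empty => simp
      | cons a r ih =>
        have ha := hr0 a (by simp)
        simp only [Multiset.map_cons, Multiset.prod_cons, ih fun b hb => hr0 b (by simp [hb]),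
          Polynomial.C_mul]
        have : Polynomial.X - Polynomial.C a =
            Polynomial.C (-a) * (1 + Polynomial.C (-a⁻¹) * Polynomial.X) := by
          rw [mul_add, ← mul_assoc, ← Polynomial.C_mul, neg_mul_neg, mul_inv_cancel₀ ha]
          simp [sub_eq_neg_add]
        rw [this]
        ring
  obtain ⟨c0, c1, c2⟩ := coeff_prod_one_add u
  have hb : ∀ t : ℂ, ‖t‖ = R → ‖g.eval t‖ ≤
      szaszBound R (g.coeff 0) (g.coeff 1) (g.coeff 2) := by
    intro t ht
    have := norm_eval_prod_one_add_le u hu t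
    rw [← c2, ← c1, ht] at this
    rw [hgu, Polynomial.eval_mul, Polynomial.eval_C, norm_mul, szaszBound]
    simp only [Polynomial.coeff_C_mul, c0, mul_one, mul_div_cancel_left₀ _ hc]
    exact mul_le_mul_of_nonneg_left this (norm_nonneg _)
  refine univariate_norm_coeff_mul_pow_le _ hR (fun t ht => ?_) d
  rw [Polynomial.eval_mul, norm_mul, Polynomial.eval_pow, Polynomial.eval_X, norm_pow, ht]
  exact mul_le_mul_of_nonneg_left (hb t ht) (by positivity)

end Szasz

section NormalFamily

variable {σ : Type*} [Fintype σ]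

open Classical in
/-- The homogeneous polynomial of degree `d` with prescribed coefficients. -/
noncomputable def homForm (a : (σ →₀ ℕ) → ℂ) (d : ℕ) : MvPolynomial σ ℂ :=
  ∑ α ∈ Finset.finsuppAntidiag Finset.univ d, a α • monomial α 1

lemma mem_finsuppAntidiag_univ [DecidableEq σ] {α : σ →₀ ℕ} {d : ℕ} :
    α ∈ Finset.finsuppAntidiag Finset.univ d ↔ α.degree = d := by
  simp [Finset.mem_finsuppAntidiag, Finsupp.degree_eq_sum]

lemma coeff_homForm (a : (σ →₀ ℕ) → ℂ) (d : ℕ) (β : σ →₀ ℕ) :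
    coeff β (homForm a d) = if β.degree = d then a β else 0 := by
  classical
  simp only [homForm, coeff_sum, coeff_smul, coeff_monomial, smul_eq_mul, mul_ite, mul_one,
    mul_zero, Finset.sum_ite_eq', mem_finsuppAntidiag_univ]

lemma homForm_coeff (f : MvPolynomial σ ℂ) (d : ℕ) :
    homForm (fun α => coeff α f) d = homogeneousComponent d f := by
  ext β
  rw [coeff_homForm, coeff_homogeneousComponent]

lemma eval_homForm [DecidableEq σ] (a : (σ →₀ ℕ) → ℂ) (d : ℕ) (v : σ → ℂ) :
    eval v (homForm a d) =
      ∑ α ∈ Finset.finsuppAntidiag Finset.univ d, a α * ∏ i, v i ^ α i := by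
  simp only [homForm, map_sum, smul_eval, eval_monomial, one_mul, Finsupp.prod_fintype,
    pow_zero, implies_true]
  congr!

lemma eval_smul_homForm (a : (σ →₀ ℕ) → ℂ) (d : ℕ) (c : ℂ) (v : σ → ℂ) :
    eval (fun i => c * v i) (homForm a d) = c ^ d * eval v (homForm a d) := by
  classical
  rw [eval_homForm, eval_homForm, Finset.mul_sum]
  refine Finset.sum_congr rfl fun α hα => ?_
  rw [mem_finsuppAntidiag_univ, Finsupp.degree_eq_sum] at hα
  simp only [mul_pow, Finset.prod_mul_distrib, Finset.prod_pow_eq_pow_sum, hα]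
  ring

lemma coeff_lineRestrict_zero (v : σ → ℂ) (f : MvPolynomial σ ℂ) (d : ℕ) :
    (lineRestrict 0 v f).coeff d = eval v (homogeneousComponent d f) := by
  induction f using MvPolynomial.induction_on' with
  | monomial α c =>
    have h1 : lineRestrict 0 v (monomial α c) =
        Polynomial.C (eval v (monomial α c)) * Polynomial.X ^ α.degree := by
      rw [lineRestrict, aeval_monomial, Finsupp.prod_fintype _ _ fun i => pow_zero _]
      simp only [Pi.zero_apply, map_zero, zero_add, eval_monomial,
        Finsupp.prod_fintype, pow_zero, implies_true, mul_pow, Finset.prod_mul_distrib,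
        Finset.prod_pow_eq_pow_sum, Finsupp.degree_eq_sum, map_mul, map_prod, map_pow,
        Polynomial.algebraMap_eq, mul_assoc]
    rw [h1, Polynomial.coeff_C_mul_X_pow, homogeneousComponent_of_mem
      ((mem_homogeneousSubmodule _ _).2 (isHomogeneous_monomial c rfl))]
    split_ifs <;> simp
  | add p q hp hq => simp [lineRestrict, ← hp, ← hq]

/-- The lowest homogeneous part of a stable polynomial is stable or zero. -/
lemma stableOrZero_homogeneousComponent {f : MvPolynomial σ ℂ} (hf : IsStable f) {s : ℕ}
    (hs : ∀ α, α.degree < s → coeff α f = 0) : StableOrZero (homogeneousComponent s f) := by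
  classical
  have hr : ∀ k : ℕ, (0 : ℝ) < 1 / (k + 1) := fun k => Nat.one_div_pos_of_nat
  have h := stableOrZero_of_tendsto_sum f.support
    (c := fun k α => (((1 / (k + 1) : ℝ) : ℂ)) ^ (α.degree - s))
    (c₀ := fun α => if α.degree = s then 1 else 0) (fun α hα => ?_)
    (fun α => monomial α (coeff α f)) (Eventually.of_forall fun k => Or.inl fun z hz => ?_)
  · convert h
    rw [homogeneousComponent_apply, Finset.sum_filter]
    refine Finset.sum_congr rfl fun α _ => ?_
    split_ifs <;> simp
  · have hle : s ≤ α.degree := by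
      by_contra! hlt
      exact mem_support_iff.1 hα (hs α hlt)
    have h0 : Tendsto (fun k : ℕ => (((1 / (k + 1) : ℝ) : ℂ))) atTop (𝓝 0) := by
      have := (Complex.continuous_ofReal.tendsto 0).comp
        (tendsto_one_div_add_atTop_nhds_zero_nat (𝕜 := ℝ))
      simpa [Function.comp_def] using this
    have := h0.pow (α.degree - s)
    convert this using 2
    split_ifs with hd
    · simp [hd]
    · rw [zero_pow (by omega)]
  · set t : ℝ := 1 / (k + 1) with ht
    have ht0 : 0 < t := hr k
    have h1 := hf (fun i => t * z i) fun i => by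
      rw [Complex.im_ofReal_mul]; exact mul_pos ht0 (hz i)
    intro h2
    apply h1
    have h3 : eval (fun i => (t : ℂ) * z i) f = (t : ℂ) ^ s *
        eval z (∑ α ∈ f.support, (t : ℂ) ^ (α.degree - s) • monomial α (coeff α f)) := by
      rw [eval_eq', map_sum, Finset.mul_sum]
      refine Finset.sum_congr rfl fun α hα => ?_
      have hle : s ≤ α.degree := by
        by_contra! hlt
        exact mem_support_iff.1 hα (hs α hlt)
      simp only [mul_pow, Finset.prod_mul_distrib, Finset.prod_pow_eq_pow_sum, smul_eval,
        eval_monomial, Finsupp.prod_fintype, pow_zero, implies_true]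
      rw [← Finsupp.degree_eq_sum, ← mul_assoc ((t : ℂ) ^ s), ← pow_add,
        Nat.add_sub_cancel' hle]
      ring
    rw [h3, h2, mul_zero]

lemma sum_neg_one_pow_mul_choose_mul_pow {n j : ℕ} (hj : j ≤ n) (x : ℂ) :
    ∑ k ∈ Finset.range (n + 1), (-1) ^ (n - k) * n.choose k * (x + k) ^ j =
      if j = n then (n.factorial : ℂ) else 0 := by
  have h := fwdDiff_iter_eq_sum_shift (1 : ℂ) (fun r => r ^ j) n x
  simp only [nsmul_eq_mul, mul_one, zsmul_eq_mul] at h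
  push_cast at h
  rw [← h]
  split_ifs with hjn
  · subst hjn
    rw [fwdDiff_iter_eq_factorial]
    rfl
  · rw [fwdDiff_iter_pow_eq_zero_of_lt (lt_of_le_of_ne hj hjn)]
    rfl

/-- Extraction of a coefficient of a homogeneous polynomial by finite differences. -/
lemma factorial_mul_coeff_eq [DecidableEq σ] (a : (σ →₀ ℕ) → ℂ) (α : σ →₀ ℕ) (x : ℂ) :
    (∏ i, ((α i).factorial : ℂ)) * a α =
      ∑ β ∈ Fintype.piFinset fun i => Finset.range (α i + 1),
        (∏ i, (-1) ^ (α i - β i) * ((α i).choose (β i) : ℂ)) *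
          eval (fun i => x + β i) (homForm a α.degree) := by
  simp only [eval_homForm, Finset.mul_sum]
  rw [Finset.sum_comm]
  have h1 : ∀ γ : σ →₀ ℕ, ∑ β ∈ Fintype.piFinset fun i => Finset.range (α i + 1),
      (∏ i, (-1) ^ (α i - β i) * ((α i).choose (β i) : ℂ)) * (a γ * ∏ i, (x + β i) ^ γ i) =
      a γ * ∏ i, ∑ k ∈ Finset.range (α i + 1),
        (-1) ^ (α i - k) * ((α i).choose k : ℂ) * (x + k) ^ γ i := fun γ => by
    rw [Finset.prod_univ_sum, Finset.mul_sum]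
    refine Finset.sum_congr rfl fun β _ => ?_
    rw [mul_left_comm, ← Finset.prod_mul_distrib]
  simp only [h1]
  rw [Finset.sum_eq_single α]
  · rw [mul_comm]
    congr 1
    refine Finset.prod_congr rfl fun i _ => ?_
    rw [sum_neg_one_pow_mul_choose_mul_pow le_rfl, if_pos rfl]
  · intro γ hγ hne
    have hd : γ.degree = α.degree := by
      have := hγ
      simp only [Finset.mem_finsuppAntidiag, Finset.subset_univ, and_true] at this
      rwa [Finsupp.degree_eq_sum]
    obtain ⟨i, hi⟩ : ∃ i, γ i < α i := by
      by_contra! hcon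
      have hsum : ∑ i, α i = ∑ i, γ i := by
        rw [← Finsupp.degree_eq_sum, ← Finsupp.degree_eq_sum, hd]
      refine hne (Finsupp.ext fun i => ?_)
      exact ((Finset.sum_eq_sum_iff_of_le fun i _ => hcon i).1 hsum i (Finset.mem_univ i)).symm
    rw [Finset.prod_eq_zero (Finset.mem_univ i), mul_zero]
    rw [sum_neg_one_pow_mul_choose_mul_pow hi.le, if_neg hi.ne]
  · intro h
    refine absurd ?_ h
    simp [Finset.mem_finsuppAntidiag, Finsupp.degree_eq_sum]

lemma norm_le_of_norm_eval_homForm_le (a : (σ →₀ ℕ) → ℂ) (α : σ →₀ ℕ) {B : ℝ}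
    (hB : ∀ v : σ → ℝ, (∀ i, v i ∈ Set.Icc 1 2) →
      ‖eval (fun i => (v i : ℂ)) (homForm a α.degree)‖ ≤ B) :
    ‖a α‖ ≤ B * (2 * Real.exp (Fintype.card σ)) ^ α.degree := by
  classical
  set d := α.degree with hd
  have hαd : ∀ i, α i ≤ d := fun i => Finsupp.le_degree i α
  have hB0 : 0 ≤ B := (norm_nonneg _).trans (hB (fun _ => 1) fun _ => by norm_num)
  have hev : ∀ β ∈ Fintype.piFinset fun i => Finset.range (α i + 1),
      ‖eval (fun i => (d : ℂ) + (β i : ℂ)) (homForm a d)‖ ≤ (d : ℝ) ^ d * B := by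
    intro β hβ
    simp only [Fintype.mem_piFinset, Finset.mem_range] at hβ
    by_cases hd0 : d = 0
    · have h := hB (fun _ => 1) fun _ => by norm_num
      have e : (fun i => (d : ℂ) + (β i : ℂ)) = fun i => 0 * ((1 : ℝ) : ℂ) := by
        ext i
        have h1 := hβ i
        have h2 := hαd i
        have : β i = 0 := by omega
        simp [this, hd0]
      rw [e, eval_smul_homForm (v := fun _ => ((1 : ℝ) : ℂ)), hd0, norm_mul] at *
      simpa using h
    · have hdpos : (0 : ℝ) < d := by exact_mod_cast Nat.pos_of_ne_zero hd0
      have h := hB (fun i => ((d : ℝ) + β i) / d) fun i => by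
        have h1 : (β i : ℝ) ≤ d := by
          have h1 := hβ i
          have h2 := hαd i
          exact_mod_cast (by omega : β i ≤ d)
        rw [Set.mem_Icc, le_div_iff₀ hdpos, div_le_iff₀ hdpos]
        constructor <;> nlinarith [(Nat.cast_nonneg (β i) : (0 : ℝ) ≤ β i)]
      have e : (fun i => (d : ℂ) + (β i : ℂ)) =
          fun i => (d : ℂ) * (((((d : ℝ) + β i) / d : ℝ)) : ℂ) := by
        ext i
        have : (d : ℂ) ≠ 0 := by exact_mod_cast hd0
        push_cast
        field_simp
      rw [e, eval_smul_homForm (v := fun i => (((((d : ℝ) + β i) / d : ℝ)) : ℂ)), norm_mul,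
        norm_pow, Complex.norm_natCast]
      exact mul_le_mul_of_nonneg_left h (by positivity)
  have h1 : (∏ i, ((α i).factorial : ℝ)) * ‖a α‖ ≤ 2 ^ d * ((d : ℝ) ^ d * B) := by
    have h2 : ‖(∏ i, ((α i).factorial : ℂ)) * a α‖ = (∏ i, ((α i).factorial : ℝ)) * ‖a α‖ := by
      simp [norm_prod]
    rw [← h2, factorial_mul_coeff_eq a α (d : ℂ)]
    refine (norm_sum_le _ _).trans ?_
    have h3 : ∑ β ∈ Fintype.piFinset fun i => Finset.range (α i + 1),
        (∏ i, ((α i).choose (β i) : ℝ)) = 2 ^ d := by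
      rw [← Finset.prod_univ_sum (fun i => Finset.range (α i + 1))
        (fun i k => ((α i).choose k : ℝ))]
      have : ∀ i, ∑ k ∈ Finset.range (α i + 1), ((α i).choose k : ℝ) = 2 ^ α i := fun i => by
        exact_mod_cast Nat.sum_range_choose (α i)
      simp only [this, Finset.prod_pow_eq_pow_sum]
      rw [hd, Finsupp.degree_eq_sum]
    rw [← h3, Finset.sum_mul]
    refine Finset.sum_le_sum fun β hβ => ?_
    rw [norm_mul, norm_prod]
    refine mul_le_mul (le_of_eq ?_) (hev β hβ) (norm_nonneg _)
      (Finset.prod_nonneg fun _ _ => Nat.cast_nonneg _)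
    simp
  have h4 : (d : ℝ) ^ d ≤ (∏ i, ((α i).factorial : ℝ)) * Real.exp (Fintype.card σ) ^ d := by
    have h5 : ∀ i, (d : ℝ) ^ α i ≤ ((α i).factorial : ℝ) * Real.exp d := fun i => by
      have := Real.pow_div_factorial_le_exp d (Nat.cast_nonneg d) (α i)
      rwa [div_le_iff₀ (by positivity), mul_comm] at this
    have h6 : (d : ℝ) ^ d = ∏ i, (d : ℝ) ^ α i := by
      rw [Finset.prod_pow_eq_pow_sum, ← Finsupp.degree_eq_sum]
    rw [h6]
    refine (Finset.prod_le_prod (fun _ _ => by positivity) fun i _ => h5 i).trans (le_of_eq ?_)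
    rw [Finset.prod_mul_distrib, Finset.prod_const, ← Real.exp_nat_mul, ← Real.exp_nat_mul,
      Finset.card_univ, mul_comm (d : ℝ)]
  have hP : 0 < ∏ i, ((α i).factorial : ℝ) := Finset.prod_pos fun i _ => by positivity
  refine le_of_mul_le_mul_left ?_ hP
  calc (∏ i, ((α i).factorial : ℝ)) * ‖a α‖ ≤ 2 ^ d * ((d : ℝ) ^ d * B) := h1
    _ ≤ 2 ^ d * (((∏ i, ((α i).factorial : ℝ)) * Real.exp (Fintype.card σ) ^ d) * B) := by gcongr
    _ = _ := by rw [mul_pow]; ring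

/-- Locally bounded coefficients of a coefficientwise limit of stable polynomials decay faster than
any geometric sequence. -/
lemma exists_norm_mul_pow_le {f : ℕ → MvPolynomial σ ℂ} (hf : ∀ k, IsStable (f k))
    {a : (σ →₀ ℕ) → ℂ} (hle : ∀ k α, ‖coeff α (f k)‖ ≤ ‖a α‖)
    (hlim : ∀ α, Tendsto (fun k => coeff α (f k)) atTop (𝓝 (a α))) {R : ℝ} (hR : 0 < R) :
    ∃ M, ∀ α, ‖a α‖ * R ^ α.degree ≤ M := by
  classical
  by_cases ha0 : ∀ α, a α = 0
  · exact ⟨0, fun α => by simp [ha0]⟩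
  push Not at ha0
  have hex : ∃ s, ∃ α, α.degree = s ∧ a α ≠ 0 := by
    obtain ⟨α, hα⟩ := ha0
    exact ⟨_, α, rfl, hα⟩
  set s := Nat.find hex with hsdef
  obtain ⟨α₀, hα₀, haα₀⟩ := Nat.find_spec hex
  have hlow : ∀ α, α.degree < s → a α = 0 := fun α hα => by
    by_contra hne
    exact Nat.find_min hex hα ⟨α, rfl, hne⟩
  have hcomp : ∀ d (v : σ → ℂ), Tendsto (fun k => eval v (homogeneousComponent d (f k))) atTop
      (𝓝 (eval v (homForm a d))) := fun d v => by
    simp only [← homForm_coeff, eval_homForm]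
    exact tendsto_finsetSum _ fun α _ => (hlim α).mul_const _
  have hA : IsStable (homForm a s) := by
    refine Or.resolve_right (stableOrZero_of_tendsto_sum (c := fun k α => coeff α (f k)) _
      (fun α _ => hlim α) _ (Eventually.of_forall fun k => ?_)) fun h => ?_
    · have := stableOrZero_homogeneousComponent (hf k) (s := s) fun α hα => by
        simpa [hlow α hα] using hle k α
      rwa [← homForm_coeff] at this
    · have h1 := coeff_homForm a s α₀
      rw [if_pos hα₀] at h1
      exact haα₀ (by rw [← h1, homForm, h, coeff_zero])
  have hApos : ∀ v : σ → ℝ, (∀ i, 0 < v i) → eval (fun i => (v i : ℂ)) (homForm a s) ≠ 0 := by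
    intro v hv h
    refine hA (fun i => Complex.I * v i) (fun i => by simpa using hv i) ?_
    rw [eval_smul_homForm (v := fun i => (v i : ℂ)), h, mul_zero]
  set R' := R * (2 * Real.exp (Fintype.card σ)) with hR'def
  have hR' : 0 < R' := by positivity
  have hmain : ∀ v : σ → ℝ, (∀ i, 0 < v i) → ∀ d,
      ‖eval (fun i => (v i : ℂ)) (homForm a d)‖ * R' ^ d ≤
        R' ^ s * szaszBound R' (eval (fun i => (v i : ℂ)) (homForm a s))
          (eval (fun i => (v i : ℂ)) (homForm a (s + 1)))
          (eval (fun i => (v i : ℂ)) (homForm a (s + 2))) := by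
    intro v hv d
    have hv0 := hApos v hv
    refine le_of_tendsto_of_tendsto
      ((hcomp d fun i => (v i : ℂ)).norm.mul_const _)
      (Tendsto.const_mul _ (?_ : Tendsto (fun k => szaszBound R'
        (eval (fun i => (v i : ℂ)) (homogeneousComponent s (f k)))
        (eval (fun i => (v i : ℂ)) (homogeneousComponent (s + 1) (f k)))
        (eval (fun i => (v i : ℂ)) (homogeneousComponent (s + 2) (f k)))) atTop _)) ?_
    · have t0 := hcomp s fun i => (v i : ℂ)
      have t1 := hcomp (s + 1) fun i => (v i : ℂ)
      have t2 := hcomp (s + 2) fun i => (v i : ℂ)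
      unfold szaszBound
      refine t0.norm.mul ((Real.continuous_exp.tendsto _).comp ?_)
      have t10 := t1.div t0 hv0
      have t20 := t2.div t0 hv0
      exact (t10.norm.const_mul _).add
        ((((t10.pow 2).sub (t20.const_mul 2)).norm.add ((t10.norm.pow 2).const_mul 2)).const_mul _)
    · filter_upwards [(hcomp s fun i => (v i : ℂ)).eventually_ne hv0] with k hk
      have h := szasz (q := lineRestrict 0 (fun i => (v i : ℂ)) (f k)) (s := s) (R := R')
        (fun t ht => ?_) (fun i hi => ?_) ?_ hR' d
      · simpa only [coeff_lineRestrict_zero] using h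
      · rw [eval_lineRestrict]
        refine hf k _ fun i => ?_
        simpa using mul_pos (hv i) ht
      · rw [coeff_lineRestrict_zero, ← homForm_coeff, eval_homForm]
        refine Finset.sum_eq_zero fun α hα => ?_
        rw [mem_finsuppAntidiag_univ] at hα
        have h1 := hle k α
        rw [hlow α (by omega), norm_zero, norm_le_zero_iff] at h1
        rw [h1, zero_mul]
      · rwa [coeff_lineRestrict_zero]
  have hK : IsCompact (Set.univ.pi fun _ : σ => Set.Icc (1 : ℝ) 2) :=
    isCompact_univ_pi fun _ => isCompact_Icc
  have hcontA : ∀ d, Continuous fun v : σ → ℝ => eval (fun i => (v i : ℂ)) (homForm a d) :=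
    fun d => (MvPolynomial.continuous_eval (homForm a d)).comp
      (continuous_pi fun i => Complex.continuous_ofReal.comp (continuous_apply i))
  have hcont : ContinuousOn (fun v : σ → ℝ =>
      R' ^ s * szaszBound R' (eval (fun i => (v i : ℂ)) (homForm a s))
          (eval (fun i => (v i : ℂ)) (homForm a (s + 1)))
          (eval (fun i => (v i : ℂ)) (homForm a (s + 2))))
      (Set.univ.pi fun _ : σ => Set.Icc (1 : ℝ) 2) := by
    have hne : ∀ v ∈ (Set.univ.pi fun _ : σ => Set.Icc (1 : ℝ) 2),
        eval (fun i => (v i : ℂ)) (homForm a s) ≠ 0 := fun v hv =>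
      hApos v fun i => lt_of_lt_of_le one_pos (hv i trivial).1
    have t0 := (hcontA s).continuousOn (s := Set.univ.pi fun _ : σ => Set.Icc (1 : ℝ) 2)
    have t10 := (hcontA (s + 1)).continuousOn.div t0 hne
    have t20 := (hcontA (s + 2)).continuousOn.div t0 hne
    unfold szaszBound
    refine continuousOn_const.mul (t0.norm.mul (Real.continuous_exp.comp_continuousOn ?_))
    exact (continuousOn_const.mul t10.norm).add (continuousOn_const.mul
      (((t10.pow 2).sub (continuousOn_const.mul t20)).norm.add
        (continuousOn_const.mul (t10.norm.pow 2))))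
  obtain ⟨M, hM⟩ := hK.bddAbove_image hcont
  refine ⟨M, fun α => ?_⟩
  have h := norm_le_of_norm_eval_homForm_le a α (B := M / R' ^ α.degree) fun v hv => by
    rw [le_div_iff₀ (by positivity)]
    exact (hmain v (fun i => lt_of_lt_of_le one_pos (hv i).1) _).trans
      (hM ⟨v, fun i _ => hv i, rfl⟩)
  refine (mul_le_mul_of_nonneg_right h (by positivity)).trans (le_of_eq ?_)
  rw [hR'def, mul_pow]
  field_simp

end NormalFamily

section ProperPairs

/-- Two nowhere real-proportional continuous functions are in one of the two possible proper
positions. -/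
lemma add_I_mul_ne_zero_or {X : Type*} [TopologicalSpace X] {S : Set X} (hS : IsPreconnected S)
    {g h : X → ℂ} (hg : ContinuousOn g S) (hh : ContinuousOn h S)
    (hgh : ∀ x ∈ S, (g x * (starRingEnd ℂ) (h x)).im ≠ 0) :
    (∀ x ∈ S, g x + Complex.I * h x ≠ 0) ∨ (∀ x ∈ S, h x + Complex.I * g x ≠ 0) := by
  set Φ : X → ℝ := fun x => (g x * (starRingEnd ℂ) (h x)).im with hΦ
  have hcont : ContinuousOn Φ S := Complex.continuous_im.comp_continuousOn
    (hg.mul (Complex.continuous_conj.comp_continuousOn hh))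
  by_contra! hcon
  obtain ⟨⟨x, hx, hx0⟩, y, hy, hy0⟩ := hcon
  have hx1 : Φ x ≤ 0 := by
    have : g x = -(Complex.I * h x) := eq_neg_of_add_eq_zero_left hx0
    simp only [hΦ, this, neg_mul, Complex.neg_im, mul_assoc, Complex.mul_conj]
    simpa using Complex.normSq_nonneg (h x)
  have hy1 : 0 ≤ Φ y := by
    have : h y = -(Complex.I * g y) := eq_neg_of_add_eq_zero_left hy0
    have e : g y * (starRingEnd ℂ) (h y) = Complex.I * (Complex.normSq (g y) : ℂ) := by
      rw [this, ← Complex.mul_conj]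
      simp only [map_neg, map_mul, Complex.conj_I]
      ring
    simp only [hΦ, e]
    simpa using Complex.normSq_nonneg (g y)
  obtain ⟨z, hz, hz0⟩ := hS.intermediate_value hx hy hcont ⟨hx1, hy1⟩
  exact hgh z hz hz0

lemma exists_real_combination_eq_zero {g h : ℂ} (hgh : (g * (starRingEnd ℂ) h).im = 0) :
    ∃ a b : ℝ, (a ≠ 0 ∨ b ≠ 0) ∧ a * g + b * h = 0 := by
  by_cases hh : h = 0
  · exact ⟨0, 1, by simp, by simp [hh]⟩
  refine ⟨Complex.normSq h, -(g * (starRingEnd ℂ) h).re, Or.inl (by simpa using hh), ?_⟩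
  have e : (((g * (starRingEnd ℂ) h).re : ℝ) : ℂ) = g * (starRingEnd ℂ) h := by
    apply Complex.ext
    · simp only [Complex.ofReal_re]
    · rw [hgh]; simp only [Complex.ofReal_im]
  rw [Complex.ofReal_neg, e, ← Complex.mul_conj]
  ring

variable {σ : Type*} [Fintype σ]

lemma differentiable_aeval (p : MvPolynomial σ ℝ) :
    Differentiable ℂ fun z : σ → ℂ => aeval z p := by
  have := differentiable_eval (map (algebraMap ℝ ℂ) p)
  simpa only [eval_map, ← aeval_def] using this

lemma continuous_aeval (p : MvPolynomial σ ℝ) : Continuous fun z : σ → ℂ => aeval z p :=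
  (differentiable_aeval p).continuous

lemma isStable_add_I_iff {σ : Type*} {p q : MvPolynomial σ ℝ} :
    IsStable (map (algebraMap ℝ ℂ) p + Complex.I • map (algebraMap ℝ ℂ) q) ↔
      ∀ z ∈ upperHalf σ, aeval z p + Complex.I * aeval z q ≠ 0 := by
  simp only [IsStable, map_add, smul_eval, eval_map, ← aeval_def]
  rfl

/-- A linear operator all of whose values are real stable or zero has the rank two form. -/
lemma exists_rank_two_form {E : Type*} [AddCommGroup E] [Module ℝ E]
    (T : E →ₗ[ℝ] MvPolynomial σ ℝ) (hT : ∀ f, IsRealStable (T f) ∨ T f = 0) :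
    ∃ (a b : E →ₗ[ℝ] ℝ) (P Q : MvPolynomial σ ℝ),
      IsRealStable P ∧ IsRealStable Q ∧ ProperPosition P Q ∧ ∀ f, T f = a f • P + b f • Q := by
  have hzero : ∀ f, ∀ z ∈ upperHalf σ, aeval z (T f) = 0 → T f = 0 := fun f z hz h =>
    (hT f).resolve_left fun hs => hs z hz h
  have hI : (fun _ : σ => Complex.I) ∈ upperHalf σ := const_I_mem_upperHalf
  have hone : IsStable (map (algebraMap ℝ ℂ) (1 : MvPolynomial σ ℝ) +
      Complex.I • map (algebraMap ℝ ℂ) 1) := by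
    rw [isStable_add_I_iff]
    intro z _ h
    simpa using congrArg Complex.re h
  by_cases hT0 : ∀ f, T f = 0
  · refine ⟨0, 0, 1, 1, fun z _ => by simp, fun z _ => by simp, hone, fun f => by simp [hT0 f]⟩
  push Not at hT0
  obtain ⟨f₁, hf₁⟩ := hT0
  set ev : E →ₗ[ℝ] ℂ := (aeval (R := ℝ) (fun _ : σ => Complex.I)).toLinearMap ∘ₗ T with hev
  have hev' : ∀ f, ev f = aeval (fun _ : σ => Complex.I) (T f) := fun f => rfl
  have hinj : ∀ f, ev f = 0 → T f = 0 := fun f h => hzero f _ hI h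
  have hS₁ := (hT f₁).resolve_right hf₁
  by_cases hdim : ∀ f, (ev f * (starRingEnd ℂ) (ev f₁)).im = 0
  · have hn : Complex.normSq (ev f₁) ≠ 0 := fun h => hf₁ (hinj _ (Complex.normSq_eq_zero.1 h))
    set a : E →ₗ[ℝ] ℝ := (Complex.normSq (ev f₁))⁻¹ • (Complex.reLm ∘ₗ
      LinearMap.mulRight ℝ ((starRingEnd ℂ) (ev f₁)) ∘ₗ ev) with ha
    refine ⟨a, 0, T f₁, T f₁, hS₁, hS₁, ?_, fun f => ?_⟩
    · rw [ProperPosition, isStable_add_I_iff]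
      intro z hz h
      have : (1 + Complex.I) * aeval z (T f₁) = 0 := by rw [← h]; ring
      rcases mul_eq_zero.1 this with h1 | h1
      · simpa using congrArg Complex.re h1
      · exact hS₁ z hz h1
    · have h0 : ev (f - a f • f₁) = 0 := by
        have e : (((ev f * (starRingEnd ℂ) (ev f₁)).re : ℝ) : ℂ) =
            ev f * (starRingEnd ℂ) (ev f₁) := by
          apply Complex.ext
          · simp only [Complex.ofReal_re]
          · rw [hdim]; simp only [Complex.ofReal_im]
        have haf : (a f : ℂ) = (Complex.normSq (ev f₁) : ℂ)⁻¹ *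
            (ev f * (starRingEnd ℂ) (ev f₁)) := by
          rw [← e]
          simp [ha]
        rw [map_sub, map_smul, Complex.real_smul, haf, mul_assoc, mul_assoc,
          mul_comm ((starRingEnd ℂ) (ev f₁)), Complex.mul_conj, mul_left_comm,
          inv_mul_cancel₀ (by exact_mod_cast hn)]
        ring
      have := hinj _ h0
      rw [map_sub, map_smul, sub_eq_zero] at this
      simpa using this
  · push Not at hdim
    obtain ⟨f₂, hf₂⟩ := hdim
    have hne : ∀ z ∈ upperHalf σ,
        (aeval z (T f₂) * (starRingEnd ℂ) (aeval z (T f₁))).im ≠ 0 := by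
      intro z hz h
      obtain ⟨a, b, hab, h0⟩ := exists_real_combination_eq_zero h
      have h1 : T (a • f₂ + b • f₁) = 0 := hzero _ z hz (by
        simpa [map_smul, Complex.real_smul] using h0)
      have h2 : (a : ℂ) * ev f₂ + b * ev f₁ = 0 := by
        have : ev (a • f₂ + b • f₁) = 0 := by rw [hev', h1, map_zero]
        simpa [map_smul, Complex.real_smul] using this
      have h3 := congrArg (fun x : ℂ => (x * (starRingEnd ℂ) (ev f₁)).im) h2
      have h4 := congrArg (fun x : ℂ => (x * (starRingEnd ℂ) (ev f₂)).im) h2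
      simp only [Complex.mul_im, Complex.add_re, Complex.add_im, Complex.mul_re,
        Complex.ofReal_re, Complex.ofReal_im, Complex.conj_re, Complex.conj_im] at h3 h4 hf₂
      simp only [Complex.zero_re, Complex.zero_im] at h3 h4
      rcases hab with ha | hb
      · exact hf₂ (mul_left_cancel₀ ha (by linarith))
      · exact hf₂ (mul_left_cancel₀ hb (by linarith))
    have hS₂ : IsRealStable (T f₂) := (hT f₂).resolve_right fun h => hf₂ (by simp [hev', h])
    set δ := (ev f₂ * (starRingEnd ℂ) (ev f₁)).im with hδ
    set a : E →ₗ[ℝ] ℝ := (-δ⁻¹) • (Complex.imLm ∘ₗ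
      LinearMap.mulRight ℝ ((starRingEnd ℂ) (ev f₂)) ∘ₗ ev) with ha
    set b : E →ₗ[ℝ] ℝ := δ⁻¹ • (Complex.imLm ∘ₗ
      LinearMap.mulRight ℝ ((starRingEnd ℂ) (ev f₁)) ∘ₗ ev) with hb
    have hform : ∀ f, T f = a f • T f₁ + b f • T f₂ := by
      intro f
      have haf : a f = -δ⁻¹ * (ev f * (starRingEnd ℂ) (ev f₂)).im := by simp [ha]
      have hbf : b f = δ⁻¹ * (ev f * (starRingEnd ℂ) (ev f₁)).im := by simp [hb]
      have h0 : ev (f - (a f • f₁ + b f • f₂)) = 0 := by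
        rw [map_sub, map_add, map_smul, map_smul, sub_eq_zero, haf, hbf]
        simp only [Complex.mul_im, Complex.conj_re, Complex.conj_im] at hf₂ hδ ⊢
        apply Complex.ext
        · simp only [Complex.add_re, Complex.smul_re, smul_eq_mul]
          field_simp
          rw [hδ]
          ring
        · simp only [Complex.add_im, Complex.smul_im, smul_eq_mul]
          field_simp
          rw [hδ]
          ring
      have := hinj _ h0
      rw [map_sub, map_add, map_smul, map_smul, sub_eq_zero] at this
      exact this
    rcases add_I_mul_ne_zero_or (convex_upperHalf (σ := σ)).isPreconnected
      (continuous_aeval (T f₂)).continuousOn (continuous_aeval (T f₁)).continuousOn hne with h | h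
    · exact ⟨a, b, T f₁, T f₂, hS₁, hS₂, isStable_add_I_iff.2 h, hform⟩
    · exact ⟨b, a, T f₂, T f₁, hS₂, hS₁, isStable_add_I_iff.2 h, fun f => by
        rw [hform, add_comm]⟩

end ProperPairs

section Box

variable {σ : Type*} [Fintype σ]

open Classical in
/-- The exponents that are at most `k` in every variable. -/
noncomputable def box (σ : Type*) [Fintype σ] (k : ℕ) : Finset (σ →₀ ℕ) :=
  (Fintype.piFinset fun _ : σ => Finset.range (k + 1)).map
    Finsupp.equivFunOnFinite.symm.toEmbedding

lemma mem_box {k : ℕ} {γ : σ →₀ ℕ} : γ ∈ box σ k ↔ ∀ i, γ i ≤ k := by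
  classical
  simp [box, Finset.mem_map_equiv, Fintype.mem_piFinset]

lemma sum_box_prod {R : Type*} [CommSemiring R] (k : ℕ) (F : σ → ℕ → R) :
    ∑ γ ∈ box σ k, ∏ i, F i (γ i) = ∏ i, ∑ a ∈ Finset.range (k + 1), F i a := by
  classical
  rw [box, Finset.sum_map, Finset.prod_univ_sum]
  congr!

lemma exists_subset_box (s : Finset (σ →₀ ℕ)) : ∃ k, s ⊆ box σ k := by
  refine ⟨s.sup Finsupp.degree, fun γ hγ => mem_box.2 fun i => ?_⟩
  exact (Finsupp.le_degree i γ).trans (Finset.le_sup (f := Finsupp.degree) hγ)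

/-- The normalized falling factorial `k (k - 1) ⋯ (k - a + 1) / k ^ a`. -/
noncomputable def mulFac (k a : ℕ) : ℝ := k.descFactorial a / (k : ℝ) ^ a

lemma mulFac_nonneg (k a : ℕ) : 0 ≤ mulFac k a := by unfold mulFac; positivity

lemma mulFac_le_one (k a : ℕ) : mulFac k a ≤ 1 := by
  unfold mulFac
  refine div_le_one_of_le₀ ?_ (by positivity)
  exact_mod_cast Nat.descFactorial_le_pow k a

lemma mulFac_of_lt {k a : ℕ} (h : k < a) : mulFac k a = 0 := by
  simp [mulFac, Nat.descFactorial_of_lt h]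

lemma tendsto_mulFac (a : ℕ) : Tendsto (fun k => mulFac k a) atTop (𝓝 1) := by
  have hz : ∀ᶠ k : ℕ in atTop, (k : ℝ) ^ a ≠ 0 := by
    filter_upwards [eventually_ge_atTop 1] with k hk
    positivity
  exact (Asymptotics.isEquivalent_iff_tendsto_one hz).1 (isEquivalent_descFactorial a)

/-- Coefficients of the approximations of the symbol of the identity operator. -/
noncomputable def symCoeff (ε : ℝ) (k : ℕ) (γ : σ →₀ ℕ) : ℝ :=
  ∏ i, (ε ^ γ i / (γ i).factorial * mulFac k (γ i))

lemma sum_symCoeff (ε : ℝ) {k : ℕ} (hk : k ≠ 0) (x : σ → ℂ) :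
    ∑ γ ∈ box σ k, (symCoeff ε k γ : ℂ) * ∏ i, x i ^ γ i = ∏ i, (1 + ε * x i / k) ^ k := by
  have h : ∀ γ : σ →₀ ℕ, (symCoeff ε k γ : ℂ) * ∏ i, x i ^ γ i =
      ∏ i, ((ε : ℂ) ^ γ i / (γ i).factorial * (mulFac k (γ i) : ℂ) * x i ^ γ i) := fun γ => by
    rw [symCoeff, Complex.ofReal_prod, ← Finset.prod_mul_distrib]
    push_cast
    rfl
  simp only [h]
  rw [sum_box_prod k fun i a => (ε : ℂ) ^ a / a.factorial * (mulFac k a : ℂ) * x i ^ a]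
  refine Finset.prod_congr rfl fun i _ => ?_
  rw [add_comm (1 : ℂ), add_pow]
  refine Finset.sum_congr rfl fun a _ => ?_
  have hk' : (k : ℂ) ≠ 0 := by exact_mod_cast hk
  have ha : ((a.factorial : ℕ) : ℂ) ≠ 0 := by exact_mod_cast a.factorial_ne_zero
  rw [mulFac, Nat.descFactorial_eq_factorial_mul_choose]
  push_cast
  rw [one_pow, div_pow, mul_pow]
  field_simp

lemma symCoeff_neg_mul (ε : ℝ) (k : ℕ) (γ : σ →₀ ℕ) (w : σ → ℂ) :
    (symCoeff ε k γ : ℂ) * ∏ i, (-w i) ^ γ i = (symCoeff (-ε) k γ : ℂ) * ∏ i, w i ^ γ i := by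
  simp only [symCoeff, Complex.ofReal_prod, ← Finset.prod_mul_distrib]
  refine Finset.prod_congr rfl fun i _ => ?_
  push_cast
  rw [neg_pow, neg_pow (ε : ℂ)]
  ring

end Box

section Dichotomy

variable {σ : Type*} [Fintype σ]

lemma exists_one_add_norm_le {w : ℂ} (hw : 0 < w.im) :
    ∃ C > 0, ∀ z : ℂ, 0 < z.im → 1 + ‖z‖ ≤ C * ‖1 - z * w‖ := by
  have hw0 : w ≠ 0 := by
    rintro rfl
    simp at hw
  have hn : 0 < ‖w‖ := norm_pos_iff.2 hw0
  refine ⟨(1 + ‖w‖⁻¹) * (‖w‖ / w.im) + ‖w‖⁻¹, by positivity, fun z hz => ?_⟩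
  have e : 1 - z * w = w * (w⁻¹ - z) := by field_simp
  have h1 : w.im / ‖w‖ ≤ ‖1 - z * w‖ := by
    rw [e, norm_mul]
    have h2 : |(w⁻¹ - z).im| ≤ ‖w⁻¹ - z‖ := Complex.abs_im_le_norm _
    have h3 : w.im / ‖w‖ ^ 2 ≤ |(w⁻¹ - z).im| := by
      refine le_trans ?_ (neg_le_abs _)
      rw [Complex.sub_im, Complex.inv_im, ← Complex.sq_norm, neg_div]
      linarith
    calc w.im / ‖w‖ = ‖w‖ * (w.im / ‖w‖ ^ 2) := by field_simp
      _ ≤ _ := mul_le_mul_of_nonneg_left (h3.trans h2) hn.le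
  have h4 : ‖z‖ ≤ ‖w‖⁻¹ * (1 + ‖1 - z * w‖) := by
    rw [inv_mul_eq_div, le_div_iff₀ hn, ← norm_mul]
    calc ‖z * w‖ = ‖1 - (1 - z * w)‖ := by congr 1; ring
      _ ≤ _ := (norm_sub_le _ _).trans (by simp)
  have h5 : 1 ≤ ‖w‖ / w.im * ‖1 - z * w‖ := by
    rw [div_mul_eq_mul_div, le_div_iff₀ hw, one_mul, mul_comm]
    rwa [div_le_iff₀ hn] at h1
  have h6 : (1 + ‖w‖⁻¹) * 1 ≤ (1 + ‖w‖⁻¹) * (‖w‖ / w.im * ‖1 - z * w‖) :=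
    mul_le_mul_of_nonneg_left h5 (by positivity)
  linarith

/-- Real part (for `c = re`) or imaginary part of the kernel `∏ (1 - z_i w_i / k) ^ k`. -/
noncomputable def kernelPart (c : ℂ → ℝ) (k : ℕ) (w : σ → ℂ) : MvPolynomial σ ℝ :=
  ∑ γ ∈ box σ k, monomial γ (c ((symCoeff (-1) k γ : ℂ) * ∏ i, w i ^ γ i))

lemma eval_kernel {k : ℕ} (hk : k ≠ 0) (w z : σ → ℂ) :
    aeval z (kernelPart Complex.re k w) + Complex.I * aeval z (kernelPart Complex.im k w) =
      ∏ i, (1 - z i * (w i / k)) ^ k := by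
  simp only [kernelPart, map_sum, aeval_monomial, Finset.mul_sum, ← Finset.sum_add_distrib]
  have h := sum_symCoeff (-1) hk fun i => z i * w i
  rw [Finset.prod_congr rfl fun i _ => by
    rw [show (1 - z i * (w i / k)) = 1 + ((-1 : ℝ) : ℂ) * (z i * w i) / k by push_cast; ring], ← h]
  refine Finset.sum_congr rfl fun γ _ => ?_
  rw [Finsupp.prod_fintype _ _ fun i => pow_zero _]
  simp only [mul_pow, Finset.prod_mul_distrib, Complex.coe_algebraMap]
  rw [← mul_assoc, ← add_mul, mul_comm Complex.I, Complex.re_add_im]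
  ring

lemma exists_norm_aeval_le {k : ℕ} (hk : k ≠ 0) {w : σ → ℂ} (hw : w ∈ upperHalf σ)
    (h : MvPolynomial σ ℝ) (hh : h.support ⊆ box σ k) :
    ∃ D > 0, ∀ z ∈ upperHalf σ, 0 < ‖∏ i, (1 - z i * (w i / k)) ^ k‖ ∧
      ‖aeval z h‖ ≤ D * ‖∏ i, (1 - z i * (w i / k)) ^ k‖ := by
  have hk' : (0 : ℝ) < k := by exact_mod_cast Nat.pos_of_ne_zero hk
  have hwk : ∀ i, 0 < (w i / k).im := fun i => by
    rw [Complex.div_natCast_im]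
    exact div_pos (hw i) hk'
  choose C hC0 hC using fun i => exists_one_add_norm_le (hwk i)
  have hP : 0 < ∏ i, C i ^ k := Finset.prod_pos fun i _ => pow_pos (hC0 i) k
  have hS : 0 ≤ ∑ γ ∈ h.support, |coeff γ h| := Finset.sum_nonneg fun _ _ => abs_nonneg _
  refine ⟨(1 + ∑ γ ∈ h.support, |coeff γ h|) * ∏ i, C i ^ k, by positivity, fun z hz => ?_⟩
  have h1 : ∏ i, (1 + ‖z i‖) ^ k ≤ (∏ i, C i ^ k) * ‖∏ i, (1 - z i * (w i / k)) ^ k‖ := by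
    rw [norm_prod, ← Finset.prod_mul_distrib]
    refine Finset.prod_le_prod (fun i _ => by positivity) fun i _ => ?_
    rw [norm_pow, ← mul_pow]
    exact pow_le_pow_left₀ (by positivity) (hC i (z i) (hz i)) k
  have h2 : ∀ γ ∈ h.support, ∏ i, ‖z i‖ ^ γ i ≤ ∏ i, (1 + ‖z i‖) ^ k := fun γ hγ => by
    refine Finset.prod_le_prod (fun i _ => by positivity) fun i _ => ?_
    calc ‖z i‖ ^ γ i ≤ (1 + ‖z i‖) ^ γ i := by gcongr; linarith
      _ ≤ _ := pow_le_pow_right₀ (by linarith [norm_nonneg (z i)]) (mem_box.1 (hh hγ) i)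
  have hpos : 0 < ∏ i, (1 + ‖z i‖) ^ k := Finset.prod_pos fun i _ => by positivity
  refine ⟨pos_of_mul_pos_right (hpos.trans_le h1) hP.le, ?_⟩
  have h3 : ‖aeval z h‖ ≤ (∑ γ ∈ h.support, |coeff γ h|) * ∏ i, (1 + ‖z i‖) ^ k := by
    rw [aeval_def, eval₂_eq', Finset.sum_mul]
    refine (norm_sum_le _ _).trans (Finset.sum_le_sum fun γ hγ => ?_)
    rw [norm_mul, norm_prod, Complex.coe_algebraMap, Complex.norm_real]
    simp only [norm_pow]
    exact mul_le_mul_of_nonneg_left (h2 γ hγ) (abs_nonneg _)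
  calc ‖aeval z h‖ ≤ (1 + ∑ γ ∈ h.support, |coeff γ h|) * ∏ i, (1 + ‖z i‖) ^ k :=
        h3.trans (mul_le_mul_of_nonneg_right (by linarith) hpos.le)
    _ ≤ _ := by
        rw [mul_assoc]
        exact mul_le_mul_of_nonneg_left h1 (by linarith)

lemma isStable_kernel {k : ℕ} (hk : k ≠ 0) {w : σ → ℂ} (hw : w ∈ upperHalf σ) :
    IsStable (map (algebraMap ℝ ℂ) (kernelPart Complex.re k w) +
      Complex.I • map (algebraMap ℝ ℂ) (kernelPart Complex.im k w)) := by
  rw [isStable_add_I_iff]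
  intro z hz
  obtain ⟨D, _, hD⟩ := exists_norm_aeval_le hk hw 0 (by simp)
  rw [eval_kernel hk]
  exact norm_pos_iff.1 (hD z hz).1

/-- Small perturbations of real combinations of the two parts of the kernel are real stable. -/
lemma exists_perturbation {k : ℕ} (hk : k ≠ 0) {w : σ → ℂ} (hw : w ∈ upperHalf σ)
    (h : MvPolynomial σ ℝ) (hh : h.support ⊆ box σ k) {a b : ℝ} (hab : a ≠ 0 ∨ b ≠ 0) :
    ∃ ε : ℝ, ε ≠ 0 ∧ (IsRealStable (a • kernelPart Complex.re k w +
        b • kernelPart Complex.im k w + ε • h) ∨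
      a • kernelPart Complex.re k w + b • kernelPart Complex.im k w + ε • h = 0) := by
  obtain ⟨D, hD0, hD⟩ := exists_norm_aeval_le hk hw h hh
  set u : ℂ := b + a * Complex.I with hu
  have hu0 : 0 < ‖u‖ := by
    rw [norm_pos_iff]
    intro h0
    rcases hab with ha | hb
    · exact ha (by simpa [hu] using congrArg Complex.im h0)
    · exact hb (by simpa [hu] using congrArg Complex.re h0)
  refine ⟨‖u‖ / (2 * D), by positivity, stableOrZero_of_stable_add_I
    (p := b • kernelPart Complex.re k w + (-a) • kernelPart Complex.im k w) ?_⟩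
  rw [isStable_add_I_iff]
  intro z hz h0
  obtain ⟨h1, h2⟩ := hD z hz
  rw [← eval_kernel hk] at h1 h2
  set g₁ := aeval z (kernelPart Complex.re k w)
  set g₂ := aeval z (kernelPart Complex.im k w)
  have e : u * (g₁ + Complex.I * g₂) = -(Complex.I * (((‖u‖ / (2 * D) : ℝ) : ℂ) * aeval z h)) := by
    simp only [map_add, map_smul, Complex.real_smul] at h0
    rw [eq_neg_iff_add_eq_zero, ← h0, hu]
    push_cast
    linear_combination (a : ℂ) * g₂ * Complex.I_sq
  have e2 := congrArg norm e
  rw [norm_mul, norm_neg, norm_mul, Complex.norm_I, one_mul, norm_mul, Complex.norm_real,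
    Real.norm_of_nonneg (by positivity)] at e2
  have h3 : ‖u‖ / (2 * D) * ‖aeval z h‖ ≤ ‖u‖ / (2 * D) * (D * ‖g₁ + Complex.I * g₂‖) :=
    mul_le_mul_of_nonneg_left h2 (by positivity)
  have h4 : ‖u‖ / (2 * D) * (D * ‖g₁ + Complex.I * g₂‖) = ‖u‖ * ‖g₁ + Complex.I * g₂‖ / 2 := by
    field_simp
  have h5 := mul_pos hu0 h1
  linarith

variable (T : MvPolynomial σ ℝ →ₗ[ℝ] MvPolynomial σ ℝ)

/-- Polynomial approximations of the symbol of `T`. -/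
noncomputable def symPoly (ε : ℝ) (k : ℕ) : MvPolynomial (σ ⊕ σ) ℝ :=
  ∑ γ ∈ box σ k, symCoeff ε k γ •
    (rename Sum.inl (T (monomial γ 1)) * rename Sum.inr (monomial γ 1))

lemma aeval_symPoly (ε : ℝ) (k : ℕ) (x : σ ⊕ σ → ℂ) :
    aeval x (symPoly T ε k) = ∑ γ ∈ box σ k, (symCoeff ε k γ : ℂ) *
      (aeval (x ∘ Sum.inl) (T (monomial γ 1)) * ∏ i, x (Sum.inr i) ^ γ i) := by
  simp only [symPoly, map_sum, map_smul, map_mul, aeval_rename, Complex.real_smul]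
  refine Finset.sum_congr rfl fun γ _ => ?_
  rw [aeval_monomial, Finsupp.prod_fintype _ _ fun i => pow_zero _]
  simp

lemma aeval_map_kernelPart (c : ℂ → ℝ) (k : ℕ) (w z : σ → ℂ) :
    aeval z (T (kernelPart c k w)) = ∑ γ ∈ box σ k,
      (c ((symCoeff (-1) k γ : ℂ) * ∏ i, w i ^ γ i) : ℂ) * aeval z (T (monomial γ 1)) := by
  have h : ∀ (γ : σ →₀ ℕ) (r : ℝ), monomial γ r = r • monomial γ 1 := fun γ r => by
    rw [smul_monomial, smul_eq_mul, mul_one]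
  simp only [kernelPart, map_sum]
  refine Finset.sum_congr rfl fun γ _ => ?_
  rw [h, map_smul, map_smul, Complex.real_smul]

lemma trichotomy (hT : ∀ f : MvPolynomial σ ℝ, IsRealStable f → IsRealStable (T f) ∨ T f = 0)
    {k : ℕ} (hk : k ≠ 0) :
    (∀ h : MvPolynomial σ ℝ, h.support ⊆ box σ k → IsRealStable (T h) ∨ T h = 0) ∨
      IsRealStable (symPoly T (-1) k) ∨ IsRealStable (symPoly T 1 k) := by
  set g : (σ → ℂ) × (σ → ℂ) → ℂ := fun x => aeval x.1 (T (kernelPart Complex.re k x.2)) with hg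
  set h : (σ → ℂ) × (σ → ℂ) → ℂ := fun x => aeval x.1 (T (kernelPart Complex.im k x.2)) with hh
  have hT' : ∀ f : MvPolynomial σ ℝ, IsRealStable f ∨ f = 0 → IsRealStable (T f) ∨ T f = 0 := by
    rintro f (hf | rfl)
    · exact hT f hf
    · exact Or.inr (map_zero T)
  have hcont : ∀ c : ℂ → ℝ, Continuous c → Continuous fun x : (σ → ℂ) × (σ → ℂ) =>
      aeval x.1 (T (kernelPart c k x.2)) := fun c hc => by
    simp only [aeval_map_kernelPart]
    refine continuous_finsetSum _ fun γ _ => ?_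
    refine (Complex.continuous_ofReal.comp (hc.comp ?_)).mul
      ((continuous_aeval _).comp continuous_fst)
    exact continuous_const.mul (continuous_finsetProd _ fun i _ =>
      ((continuous_apply i).comp continuous_snd).pow _)
  by_cases hgh : ∀ x ∈ upperHalf σ ×ˢ upperHalf σ, (g x * (starRingEnd ℂ) (h x)).im ≠ 0
  · right
    have hconv : IsPreconnected (upperHalf σ ×ˢ upperHalf σ) :=
      convex_upperHalf.isPreconnected.prod convex_upperHalf.isPreconnected
    rcases add_I_mul_ne_zero_or hconv (hcont _ Complex.continuous_re).continuousOn
      (hcont _ Complex.continuous_im).continuousOn hgh with hs | hs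
    · left
      intro x hx
      have h1 := hs (x ∘ Sum.inl, x ∘ Sum.inr) ⟨fun i => hx _, fun i => hx _⟩
      rw [aeval_symPoly]
      convert h1 using 1
      simp only [aeval_map_kernelPart, Finset.mul_sum, ← Finset.sum_add_distrib]
      refine Finset.sum_congr rfl fun γ _ => ?_
      rw [← mul_assoc Complex.I, ← add_mul, mul_comm Complex.I, Complex.re_add_im]
      simp only [Function.comp_apply]
      ring
    · right
      intro x hx h0
      refine hs (x ∘ Sum.inl, fun i => -(starRingEnd ℂ) (x (Sum.inr i)))
        ⟨fun i => hx _, fun i => by simpa using hx (Sum.inr i)⟩ ?_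
      have h1 : ∀ c : ℂ, (c.im : ℂ) + Complex.I * c.re = Complex.I * (starRingEnd ℂ) c :=
        fun c => by apply Complex.ext <;> simp
      rw [aeval_symPoly] at h0
      simp only [aeval_map_kernelPart, Finset.mul_sum, ← Finset.sum_add_distrib, ← mul_assoc,
        ← add_mul, h1]
      rw [← mul_zero Complex.I, ← h0, Finset.mul_sum]
      refine Finset.sum_congr rfl fun γ _ => ?_
      rw [map_mul, Complex.conj_ofReal, map_prod]
      simp only [map_pow, map_neg, Complex.conj_conj]
      rw [symCoeff_neg_mul (-1) k γ fun i => x (Sum.inr i), neg_neg]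
      ring
  · left
    push Not at hgh
    obtain ⟨⟨z, w⟩, ⟨hz, hw⟩, h0⟩ := hgh
    obtain ⟨a, b, hab, h1⟩ := exists_real_combination_eq_zero h0
    have h2 : T (a • kernelPart Complex.re k w + b • kernelPart Complex.im k w) = 0 := by
      refine (hT' _ (stableOrZero_combination (isStable_kernel hk hw) a b)).resolve_left
        fun hs => hs z hz ?_
      simpa [hg, hh, Complex.real_smul] using h1
    intro p hp
    obtain ⟨ε, hε, hs⟩ := exists_perturbation hk hw p hp hab
    have h3 := hT' _ hs
    rw [map_add, h2, zero_add, map_smul] at h3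
    rcases h3 with h3 | h3
    · left
      intro y hy h4
      exact h3 y hy (by rw [map_smul, h4, smul_zero])
    · right
      exact (smul_eq_zero.1 h3).resolve_left hε

end Dichotomy

section SymbolLimit

lemma coeff_rename_inl_mul_rename_inr {σ τ R : Type*} [CommSemiring R] (p : MvPolynomial σ R)
    (γ α : τ →₀ ℕ) (β : σ →₀ ℕ) [Decidable (α = γ)] :
    coeff (Finsupp.sumElim β α) (rename Sum.inl p * rename Sum.inr (monomial γ 1)) =
      if α = γ then coeff β p else 0 := by
  classical
  have hsum : ∀ β' : σ →₀ ℕ, Finsupp.mapDomain Sum.inl β' + Finsupp.mapDomain Sum.inr γ =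
      Finsupp.sumElim β' γ := fun β' => by
    ext (i | i)
    · rw [Finsupp.add_apply, Finsupp.mapDomain_apply Sum.inl_injective,
        Finsupp.mapDomain_of_notMem_range _ _ (by simp), add_zero, Finsupp.sumElim_inl]
    · rw [Finsupp.add_apply, Finsupp.mapDomain_apply Sum.inr_injective,
        Finsupp.mapDomain_of_notMem_range _ _ (by simp), zero_add, Finsupp.sumElim_inr]
  have hinj : ∀ β', Finsupp.sumElim β' γ = Finsupp.sumElim β α ↔ β' = β ∧ α = γ := fun β' => by
    constructor
    · intro h
      refine ⟨Finsupp.ext fun i => ?_, Finsupp.ext fun i => ?_⟩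
      · simpa using DFunLike.congr_fun h (Sum.inl i)
      · simpa using (DFunLike.congr_fun h (Sum.inr i)).symm
    · rintro ⟨rfl, rfl⟩
      rfl
  induction p using MvPolynomial.induction_on' with
  | monomial β' c =>
    rw [rename_monomial, rename_monomial, monomial_mul, mul_one, hsum, coeff_monomial,
      coeff_monomial]
    simp only [hinj]
    split_ifs <;> simp_all
  | add p q hp hq =>
    rw [map_add, add_mul, coeff_add, hp, hq, coeff_add]
    split_ifs <;> simp

variable {σ : Type*} [Fintype σ]

lemma sum_half_pow_degree_le (s : Finset (σ →₀ ℕ)) :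
    ∑ γ ∈ s, (1 / 2 : ℝ) ^ γ.degree ≤ 2 ^ Fintype.card σ := by
  obtain ⟨k, hk⟩ := exists_subset_box s
  refine (Finset.sum_le_sum_of_subset_of_nonneg hk fun _ _ _ => by positivity).trans ?_
  have h : ∀ γ : σ →₀ ℕ, (1 / 2 : ℝ) ^ γ.degree = ∏ i, (1 / 2 : ℝ) ^ γ i := fun γ => by
    rw [Finset.prod_pow_eq_pow_sum, Finsupp.degree_eq_sum]
  simp only [h]
  rw [sum_box_prod k fun _ a => (1 / 2 : ℝ) ^ a, Finset.prod_const, Finset.card_univ]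
  refine pow_le_pow_left₀ (Finset.sum_nonneg fun _ _ => by positivity) ?_ _
  exact (Summable.sum_le_tsum _ (fun _ _ => by positivity) summable_geometric_two).trans
    (le_of_eq tsum_geometric_two)

lemma summable_half_pow_degree : Summable fun γ : σ →₀ ℕ => (1 / 2 : ℝ) ^ γ.degree :=
  summable_of_sum_le (fun _ => by positivity) sum_half_pow_degree_le

/-- The product of normalized falling factorials indexed by an exponent. -/
noncomputable def mulFacs (k : ℕ) (γ : σ →₀ ℕ) : ℝ := ∏ i, mulFac k (γ i)

lemma mulFacs_nonneg (k : ℕ) (γ : σ →₀ ℕ) : 0 ≤ mulFacs k γ :=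
  Finset.prod_nonneg fun _ _ => mulFac_nonneg _ _

lemma mulFacs_le_one (k : ℕ) (γ : σ →₀ ℕ) : mulFacs k γ ≤ 1 :=
  Finset.prod_le_one (fun _ _ => mulFac_nonneg _ _) fun _ _ => mulFac_le_one _ _

lemma mulFacs_eq_zero {k : ℕ} {γ : σ →₀ ℕ} (h : γ ∉ box σ k) : mulFacs k γ = 0 := by
  rw [mem_box] at h
  push Not at h
  obtain ⟨i, hi⟩ := h
  exact Finset.prod_eq_zero (Finset.mem_univ i) (mulFac_of_lt hi)

lemma tendsto_mulFacs (γ : σ →₀ ℕ) : Tendsto (fun k => mulFacs k γ) atTop (𝓝 1) := by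
  simpa [mulFacs] using tendsto_finsetProd Finset.univ fun i _ => tendsto_mulFac (γ i)

/-- The coefficient `ε ^ |γ| / γ!`. -/
noncomputable def expCoeff (ε : ℝ) (γ : σ →₀ ℕ) : ℝ := ∏ i, ε ^ γ i / (γ i).factorial

lemma symCoeff_eq (ε : ℝ) (k : ℕ) (γ : σ →₀ ℕ) :
    symCoeff ε k γ = mulFacs k γ * expCoeff ε γ := by
  rw [symCoeff, Finset.prod_mul_distrib, mul_comm, mulFacs, expCoeff]

lemma transSymbolTermR_eq {n : ℕ} (ε : ℝ)
    (T : MvPolynomial (Fin n) ℝ →ₗ[ℝ] MvPolynomial (Fin n) ℝ) (α : Fin n →₀ ℕ)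
    (x : Fin n ⊕ Fin n → ℂ) :
    transSymbolTermR ε T α x =
      expCoeff ε α * (aeval (x ∘ Sum.inl) (T (monomial α 1)) * ∏ i, x (Sum.inr i) ^ α i) := by
  rw [transSymbolTermR, expCoeff, Finsupp.sum_fintype _ _ fun _ => rfl,
    Finsupp.prod_fintype _ _ fun _ => by simp, Finset.prod_div_distrib,
    Finset.prod_pow_eq_pow_sum]
  push_cast
  ring

lemma coeff_symPoly (T : MvPolynomial σ ℝ →ₗ[ℝ] MvPolynomial σ ℝ) (ε : ℝ) (k : ℕ)
    (β α : σ →₀ ℕ) : coeff (Finsupp.sumElim β α) (symPoly T ε k) =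
      mulFacs k α * (expCoeff ε α * coeff β (T (monomial α 1))) := by
  classical
  simp only [symPoly, coeff_sum, coeff_smul, coeff_rename_inl_mul_rename_inr, smul_eq_mul,
    mul_ite, mul_zero, Finset.sum_ite_eq]
  split_ifs with h
  · rw [symCoeff_eq, mul_assoc]
  · rw [mulFacs_eq_zero h, zero_mul]

/-- If infinitely many polynomial approximations of the symbol are real stable, then the symbol
converges to an entire function in the Laguerre–Pólya class. -/
lemma exists_symbol_of_isRealStable {n : ℕ} (ε : ℝ)
    (T : MvPolynomial (Fin n) ℝ →ₗ[ℝ] MvPolynomial (Fin n) ℝ) {φ : ℕ → ℕ} (hφ : StrictMono φ)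
    (hs : ∀ j, IsRealStable (symPoly T ε (φ j))) :
    ∃ F : (Fin n ⊕ Fin n → ℂ) → ℂ,
      (∀ x, HasSum (fun α : Fin n →₀ ℕ => transSymbolTermR ε T α x) (F x)) ∧
        InLaguerrePolyaR n F := by
  have hbound : ∀ R : ℝ, 0 < R → ∃ M, ∀ β α : Fin n →₀ ℕ,
      ‖expCoeff ε α * coeff β (T (monomial α 1))‖ * R ^ (β.degree + α.degree) ≤ M := by
    intro R hR
    set E := (Finsupp.sumFinsuppEquivProdFinsupp (α := Fin n) (β := Fin n) (γ := ℕ)) with hE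
    have hEs : ∀ δ, Finsupp.sumElim (E δ).1 (E δ).2 = δ := fun δ => E.symm_apply_apply δ
    have hEs' : ∀ β α, E (Finsupp.sumElim β α) = (β, α) := fun β α => E.apply_symm_apply (β, α)
    have hco : ∀ k δ, coeff δ (map (algebraMap ℝ ℂ) (symPoly T ε k)) = (mulFacs k (E δ).2 : ℂ) *
        ((expCoeff ε (E δ).2 * coeff (E δ).1 (T (monomial (E δ).2 1)) : ℝ) : ℂ) := fun k δ => by
      rw [coeff_map, ← hEs δ, coeff_symPoly, hEs']
      simp
    obtain ⟨M, hM⟩ := exists_norm_mul_pow_le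
      (f := fun j => map (algebraMap ℝ ℂ) (symPoly T ε (φ j)))
      (fun j => isRealStable_iff.1 (hs j))
      (a := fun δ => ((expCoeff ε (E δ).2 * coeff (E δ).1 (T (monomial (E δ).2 1)) : ℝ) : ℂ))
      (fun j δ => by
        rw [hco, norm_mul, Complex.norm_real, Real.norm_of_nonneg (mulFacs_nonneg _ _)]
        exact mul_le_of_le_one_left (norm_nonneg _) (mulFacs_le_one _ _))
      (fun δ => by
        simp only [hco]
        have h1 := (Complex.continuous_ofReal.tendsto 1).comp
          ((tendsto_mulFacs (E δ).2).comp hφ.tendsto_atTop)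
        simpa [Function.comp_def] using h1.mul_const _) hR
    refine ⟨M, fun β α => ?_⟩
    have h := hM (Finsupp.sumElim β α)
    simp only [hEs', Complex.norm_real] at h
    convert h using 3
    simp [Finsupp.degree_eq_sum]
  have hterm : ∀ ρ : ℝ, 0 < ρ → ∃ u : (Fin n →₀ ℕ) → ℝ, Summable u ∧
      ∀ x : Fin n ⊕ Fin n → ℂ, (∀ i, ‖x i‖ ≤ ρ) → ∀ α, ‖transSymbolTermR ε T α x‖ ≤ u α := by
    intro ρ hρ
    obtain ⟨M, hM⟩ := hbound (2 * ρ) (by positivity)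
    have hM0 : 0 ≤ M := le_trans (by positivity) (hM 0 0)
    refine ⟨fun α => M * 2 ^ Fintype.card (Fin n) * (1 / 2 : ℝ) ^ α.degree,
      summable_half_pow_degree.mul_left _, fun x hx α => ?_⟩
    have hmon : ∀ (e : Fin n → Fin n ⊕ Fin n) (γ : Fin n →₀ ℕ),
        ∏ i, ‖x (e i)‖ ^ γ i ≤ ρ ^ γ.degree := fun e γ => by
      rw [Finsupp.degree_eq_sum, ← Finset.prod_pow_eq_pow_sum]
      exact Finset.prod_le_prod (fun _ _ => by positivity) fun i _ =>
        pow_le_pow_left₀ (norm_nonneg _) (hx _) _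
    rw [transSymbolTermR_eq, aeval_def, eval₂_eq', ← mul_assoc, Finset.mul_sum, norm_mul,
      norm_prod]
    simp only [norm_pow]
    have h1 : ‖∑ β ∈ (T (monomial α 1)).support, (expCoeff ε α : ℂ) *
        ((algebraMap ℝ ℂ) (coeff β (T (monomial α 1))) * ∏ i, (x ∘ Sum.inl) i ^ β i)‖ ≤
        ∑ β ∈ (T (monomial α 1)).support,
          ‖expCoeff ε α * coeff β (T (monomial α 1))‖ * ρ ^ β.degree := by
      refine (norm_sum_le _ _).trans (Finset.sum_le_sum fun β _ => ?_)
      rw [← mul_assoc, norm_mul, norm_prod, Complex.coe_algebraMap, ← Complex.ofReal_mul,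
        Complex.norm_real]
      simp only [norm_pow, Function.comp_apply]
      exact mul_le_mul_of_nonneg_left (hmon Sum.inl β) (norm_nonneg _)
    calc _ ≤ (∑ β ∈ (T (monomial α 1)).support,
          ‖expCoeff ε α * coeff β (T (monomial α 1))‖ * ρ ^ β.degree) * ρ ^ α.degree :=
          mul_le_mul h1 (hmon Sum.inr α) (by positivity) (by positivity)
      _ = ∑ β ∈ (T (monomial α 1)).support,
          (‖expCoeff ε α * coeff β (T (monomial α 1))‖ * (2 * ρ) ^ (β.degree + α.degree)) *
            ((1 / 2) ^ β.degree * (1 / 2) ^ α.degree) := by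
          rw [Finset.sum_mul]
          refine Finset.sum_congr rfl fun β _ => ?_
          rw [pow_add, mul_pow, mul_pow, one_div, inv_pow, inv_pow]
          field_simp
      _ ≤ ∑ β ∈ (T (monomial α 1)).support, M * ((1 / 2) ^ β.degree * (1 / 2) ^ α.degree) :=
          Finset.sum_le_sum fun β _ => mul_le_mul_of_nonneg_right (hM β α) (by positivity)
      _ = M * (∑ β ∈ (T (monomial α 1)).support, (1 / 2) ^ β.degree) * (1 / 2) ^ α.degree := by
          rw [Finset.mul_sum, Finset.sum_mul]
          exact Finset.sum_congr rfl fun β _ => (mul_assoc _ _ _).symm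
      _ ≤ _ := mul_le_mul_of_nonneg_right
          (mul_le_mul_of_nonneg_left (sum_half_pow_degree_le _) hM0) (by positivity)
  have hsum : ∀ x, Summable fun α : Fin n →₀ ℕ => transSymbolTermR ε T α x := fun x => by
    obtain ⟨u, hu, hxu⟩ := hterm (1 + ‖x‖) (by positivity)
    exact Summable.of_norm_bounded hu
      (hxu x fun i => (norm_le_pi_norm x i).trans (by linarith))
  refine ⟨fun x => ∑' α, transSymbolTermR ε T α x, fun x => (hsum x).hasSum,
    fun j => symPoly T ε (φ j), hs, fun K hK => ?_⟩
  obtain ⟨ρ, hρ⟩ := hK.isBounded.exists_norm_le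
  obtain ⟨u, hu, hxu⟩ := hterm (1 + |ρ|) (by positivity)
  have hu0 : ∀ α, 0 ≤ u α := fun α => (norm_nonneg _).trans
    (hxu 0 (fun i => by simp; positivity) α)
  have hlim : Tendsto (fun j => ∑' α, (1 - mulFacs (φ j) α) * u α) atTop
      (𝓝 (∑' _ : Fin n →₀ ℕ, (0 : ℝ))) := by
    refine tendsto_tsum_of_dominated_convergence hu (fun α => ?_)
      (Eventually.of_forall fun j α => ?_)
    · have := (((tendsto_mulFacs α).comp hφ.tendsto_atTop).const_sub 1).mul_const (u α)
      simpa [Function.comp_def] using this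
    · rw [norm_mul, Real.norm_of_nonneg (hu0 α), Real.norm_of_nonneg
        (by linarith [mulFacs_le_one (φ j) α])]
      exact mul_le_of_le_one_left (hu0 α) (by linarith [mulFacs_nonneg (φ j) α])
  rw [tsum_zero] at hlim
  rw [Metric.tendstoUniformlyOn_iff]
  intro δ hδ
  filter_upwards [hlim.eventually_lt_const hδ] with j hj x hx
  have hxρ : ∀ i, ‖x i‖ ≤ 1 + |ρ| := fun i =>
    (norm_le_pi_norm x i).trans ((hρ x hx).trans (by linarith [le_abs_self ρ]))
  have hfin : aeval x (symPoly T ε (φ j)) =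
      ∑' α, (mulFacs (φ j) α : ℂ) * transSymbolTermR ε T α x := by
    rw [aeval_symPoly, tsum_eq_sum (s := box (Fin n) (φ j)) fun α hα => by
      rw [mulFacs_eq_zero hα, Complex.ofReal_zero, zero_mul]]
    refine Finset.sum_congr rfl fun α _ => ?_
    rw [transSymbolTermR_eq, symCoeff_eq]
    push_cast
    ring
  have hb : ∀ α, ‖transSymbolTermR ε T α x - (mulFacs (φ j) α : ℂ) * transSymbolTermR ε T α x‖ ≤
      (1 - mulFacs (φ j) α) * u α := fun α => by
    rw [← one_sub_mul, norm_mul, ← Complex.ofReal_one, ← Complex.ofReal_sub, Complex.norm_real,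
      Real.norm_of_nonneg (by linarith [mulFacs_le_one (φ j) α])]
    exact mul_le_mul_of_nonneg_left (hxu x hxρ α) (by linarith [mulFacs_le_one (φ j) α])
  have hus : Summable fun α => (1 - mulFacs (φ j) α) * u α :=
    Summable.of_nonneg_of_le
      (fun α => mul_nonneg (by linarith [mulFacs_le_one (φ j) α]) (hu0 α))
      (fun α => mul_le_of_le_one_left (hu0 α) (by linarith [mulFacs_nonneg (φ j) α])) hu
  have hms : Summable fun α => (mulFacs (φ j) α : ℂ) * transSymbolTermR ε T α x := by
    refine Summable.of_norm_bounded hu fun α => ?_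
    rw [norm_mul, Complex.norm_real, Real.norm_of_nonneg (mulFacs_nonneg _ _)]
    exact (mul_le_of_le_one_left (norm_nonneg _) (mulFacs_le_one _ _)).trans (hxu x hxρ α)
  rw [dist_eq_norm, hfin, ← (hsum x).tsum_sub hms]
  exact (tsum_of_norm_bounded hus.hasSum hb).trans_lt hj

end SymbolLimit

section Necessity

/-- The necessary conditions on a real stability preserver. -/
lemma rank_two_or_symbol_of_preserves {n : ℕ}
    {T : MvPolynomial (Fin n) ℝ →ₗ[ℝ] MvPolynomial (Fin n) ℝ}
    (hT : ∀ f, IsRealStable f → IsRealStable (T f) ∨ T f = 0) :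
    (∃ (a b : MvPolynomial (Fin n) ℝ →ₗ[ℝ] ℝ) (P Q : MvPolynomial (Fin n) ℝ),
        IsRealStable P ∧ IsRealStable Q ∧ ProperPosition P Q ∧ ∀ f, T f = a f • P + b f • Q) ∨
      (∃ F : (Fin n ⊕ Fin n → ℂ) → ℂ,
        (∀ x, HasSum (fun α : Fin n →₀ ℕ => transSymbolTermR (-1) T α x) (F x)) ∧
          InLaguerrePolyaR n F) ∨
      (∃ F : (Fin n ⊕ Fin n → ℂ) → ℂ,
        (∀ x, HasSum (fun α : Fin n →₀ ℕ => transSymbolTermR 1 T α x) (F x)) ∧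
          InLaguerrePolyaR n F) := by
  by_cases h1 : ∃ᶠ k in atTop, IsRealStable (symPoly T (-1) k)
  · obtain ⟨φ, hφ, hs⟩ := extraction_of_frequently_atTop h1
    exact Or.inr (Or.inl (by simpa using exists_symbol_of_isRealStable (-1) T hφ hs))
  by_cases h2 : ∃ᶠ k in atTop, IsRealStable (symPoly T 1 k)
  · obtain ⟨φ, hφ, hs⟩ := extraction_of_frequently_atTop h2
    exact Or.inr (Or.inr (by simpa using exists_symbol_of_isRealStable 1 T hφ hs))
  refine Or.inl (exists_rank_two_form T fun f => ?_)
  obtain ⟨m, hm⟩ := exists_subset_box f.support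
  obtain ⟨k, hk1, hk2, hkm⟩ := ((not_frequently.1 h1).and
    ((not_frequently.1 h2).and (eventually_ge_atTop (m + 1)))).exists
  refine ((trichotomy T hT (k := k) (by omega)).resolve_right (not_or.2 ⟨hk1, hk2⟩)) f
    fun γ hγ => mem_box.2 fun i => ?_
  exact (mem_box.1 (hm hγ) i).trans (by omega)

end Necessity

section Sufficiency

lemma tendstoUniformlyOn_sum_mul {X ι : Type*} [TopologicalSpace X] {K : Set X}
    (hK : IsCompact K) (s : Finset ι) {c : ℕ → ι → ℂ} {c₀ : ι → ℂ} {u : ℕ → ι → X → ℂ}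
    {v : ι → X → ℂ} (hc : ∀ i ∈ s, Tendsto (fun k => c k i) atTop (𝓝 (c₀ i)))
    (hv : ∀ i ∈ s, ContinuousOn (v i) K)
    (hu : ∀ i ∈ s, TendstoUniformlyOn (fun k => u k i) (v i) atTop K) :
    TendstoUniformlyOn (fun k x => ∑ i ∈ s, c k i * u k i x) (fun x => ∑ i ∈ s, c₀ i * v i x)
      atTop K := by
  classical
  induction s using Finset.induction_on with
  | empty => simpa using (tendsto_const_nhds (x := (0 : ℂ))).tendstoUniformlyOn_const K
  | insert j s hj ih =>
    simp only [Finset.sum_insert hj]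
    refine TendstoUniformlyOn.fun_add ?_ (ih (fun i hi => hc i (by simp [hi]))
      (fun i hi => hv i (by simp [hi])) fun i hi => hu i (by simp [hi]))
    rw [← tendstoLocallyUniformlyOn_iff_tendstoUniformlyOn_of_compact hK]
    exact TendstoLocallyUniformlyOn.mul₀
      ((hc j (by simp)).tendstoUniformlyOn_const K).tendstoLocallyUniformlyOn
      (hu j (by simp)).tendstoLocallyUniformlyOn continuousOn_const (hv j (by simp))

lemma norm_coeff_sub_le {σ : Type*} [Fintype σ] {p : MvPolynomial σ ℂ} {t : (σ →₀ ℕ) → ℂ}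
    {Φ : (σ → ℂ) → ℂ} (hΦ : ∀ w, HasSum (fun α => t α * ∏ i, w i ^ α i) (Φ w)) {ε : ℝ}
    (h : ∀ w : σ → ℂ, (∀ i, ‖w i‖ = 1) → ‖eval w p - Φ w‖ ≤ ε) (α : σ →₀ ℕ) :
    ‖coeff α p - t α‖ ≤ ε := by
  classical
  refine le_of_forall_pos_le_add fun δ hδ => ?_
  have ht : Summable fun α => ‖t α‖ := by simpa using (hΦ 1).summable.norm
  obtain ⟨s, hs, hαs⟩ := (((_root_.tendsto_tsum_compl_atTop_zero fun α => ‖t α‖).eventually_lt_const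
    hδ).and (eventually_ge_atTop {α})).exists
  have hcoeff : coeff α (p - ∑ β ∈ s, monomial β (t β)) = coeff α p - t α := by
    rw [coeff_sub, coeff_sum]
    simp only [coeff_monomial, Finset.sum_ite_eq']
    rw [if_pos (hαs (Finset.mem_singleton_self α))]
  have := norm_coeff_mul_pow_le (p - ∑ β ∈ s, monomial β (t β)) one_pos (ε := ε + δ)
    (fun w hw => ?_) α
  · rwa [one_pow, mul_one, hcoeff] at this
  have hw1 : ∀ β, ‖t β * ∏ i, w i ^ β i‖ = ‖t β‖ := fun β => by simp [hw]
  have htail : Φ w - ∑ β ∈ s, t β * ∏ i, w i ^ β i =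
      ∑' β : {β // β ∉ s}, t β * ∏ i, w i ^ (β : σ →₀ ℕ) i := by
    rw [← (hΦ w).tsum_eq, ← (hΦ w).summable.sum_add_tsum_subtype_compl s, add_sub_cancel_left]
  have htail' : ‖Φ w - ∑ β ∈ s, t β * ∏ i, w i ^ β i‖ ≤ δ := by
    rw [htail]
    refine (norm_tsum_le_tsum_norm ?_).trans ?_
    · simp only [hw1]
      exact ht.subtype _
    · simpa only [hw1] using hs.le
  have hev : eval w (p - ∑ β ∈ s, monomial β (t β)) =
      (eval w p - Φ w) + (Φ w - ∑ β ∈ s, t β * ∏ i, w i ^ β i) := by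
    rw [map_sub, map_sum]
    simp only [eval_monomial, Finsupp.prod_pow]
    ring
  rw [hev]
  exact (norm_add_le _ _).trans (add_le_add (h w hw) htail')

variable {n : ℕ}

/-- Substitution of constants for the first half of the variables. -/
noncomputable def evalLeft {σ τ : Type*} (z : σ → ℂ) :
    MvPolynomial (σ ⊕ τ) ℂ →ₐ[ℂ] MvPolynomial τ ℂ :=
  aeval (Sum.elim (fun i => C (z i)) X)

lemma eval_evalLeft {σ τ : Type*} (z : σ → ℂ) (w : τ → ℂ) (p : MvPolynomial (σ ⊕ τ) ℂ) :
    eval w (evalLeft z p) = eval (Sum.elim z w) p := by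
  induction p using MvPolynomial.induction_on with
  | C c => simp [evalLeft]
  | add p q hp hq => rw [map_add, map_add, hp, hq, map_add]
  | mul_X p i hp => cases i <;> simp_all [evalLeft]

/-- The approximate contractions pair the second half of the variables of `p` with those
of `q`. -/
lemma exists_contraction_eval {σ τ : Type*} [Fintype σ] [Fintype τ] (k : ℕ) :
    ∃ R : MvPolynomial ((σ ⊕ τ) ⊕ τ) ℂ →ₗ[ℂ] MvPolynomial σ ℂ,
      (∀ f, StableOrZero f → StableOrZero (R f)) ∧
      ∀ p q z, eval z (R (rename Sum.inl p * rename Sum.inr q)) =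
        ∑ α ∈ q.support, (∏ j, contractCoeff k (α j) (α j)) * coeff α q *
          coeff α (evalLeft z p) := by
  classical
  obtain ⟨R, hR, hRm⟩ := exists_contraction (ι := τ) (σ := (σ ⊕ τ) ⊕ τ)
    (a := fun j => Sum.inl (Sum.inr j)) (b := Sum.inr)
    (Sum.inl_injective.comp Sum.inr_injective) Sum.inr_injective (by simp) k Finset.univ
  set S : MvPolynomial ((σ ⊕ τ) ⊕ τ) ℂ →ₐ[ℂ] MvPolynomial σ ℂ :=
    aeval (Sum.elim (Sum.elim X fun _ => C Complex.I) fun _ => C Complex.I) with hS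
  have hSe : ∀ z p, eval z (S p) =
      eval (Sum.elim (Sum.elim z fun _ => Complex.I) fun _ => Complex.I) p := fun z p => by
    induction p using MvPolynomial.induction_on with
    | C c => simp [hS]
    | add p q hp hq => rw [map_add, map_add, hp, hq, map_add]
    | mul_X p i hp => rcases i with (i | i) | i <;> simp_all
  refine ⟨S.toLinearMap ∘ₗ R, fun f hf => ?_, fun p q z => ?_⟩
  · refine (hR f hf).imp (fun h z hz => ?_) fun h => ?_
    · rw [LinearMap.comp_apply, AlgHom.toLinearMap_apply, hSe]
      refine h _ ?_
      rintro ((i | i) | i) <;> simp [hz]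
    · rw [LinearMap.comp_apply, h, map_zero]
  have key : ∀ p α c, eval z (S (R (rename Sum.inl p * rename Sum.inr (monomial α c)))) =
      (∏ j, contractCoeff k (α j) (α j)) * c * coeff α (evalLeft z p) := fun p α c => by
    induction p using MvPolynomial.induction_on' with
    | add p q hp hq => simp only [map_add, add_mul, hp, hq, coeff_add, mul_add]
    | monomial δ d =>
      rw [rename_monomial, rename_monomial, monomial_mul]
      set m := Finsupp.mapDomain (Sum.inl : σ ⊕ τ → (σ ⊕ τ) ⊕ τ) δ +
        Finsupp.mapDomain (Sum.inr : τ → (σ ⊕ τ) ⊕ τ) α with hm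
      have hml : ∀ i, m (Sum.inl i) = δ i := fun i => by
        rw [hm, Finsupp.add_apply, Finsupp.mapDomain_apply Sum.inl_injective,
          Finsupp.mapDomain_of_notMem_range _ _ (by simp), add_zero]
      have hmr : ∀ i, m (Sum.inr i) = α i := fun i => by
        rw [hm, Finsupp.add_apply, Finsupp.mapDomain_apply Sum.inr_injective,
          Finsupp.mapDomain_of_notMem_range _ _ (by simp), zero_add]
      obtain ⟨m', hm', hmm⟩ := hRm m (d * c)
      rw [hmm, hSe, eval_monomial, Finsupp.prod_pow, Fintype.prod_sum_type,
        Fintype.prod_sum_type]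
      have hl : evalLeft z (monomial δ d) = monomial (δ.comapDomain Sum.inr
          Sum.inr_injective.injOn) (d * ∏ i, z i ^ δ (Sum.inl i)) := by
        rw [evalLeft, aeval_monomial, Finsupp.prod_pow, Fintype.prod_sum_type, monomial_eq,
          Finsupp.prod_pow]
        simp [mul_assoc]
      rw [hl, coeff_monomial]
      simp only [hm', hml, hmr]
      split_ifs with h
      · subst h
        simp
        ring
      · obtain ⟨j, hj⟩ : ∃ j, δ (Sum.inr j) ≠ α j := by
          by_contra! hcon
          exact h (Finsupp.ext hcon)
        rw [Finset.prod_eq_zero (Finset.mem_univ j) (by simp [contractCoeff, hj])]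
        simp
  conv_lhs => rw [q.as_sum]
  simp only [map_sum, Finset.mul_sum, LinearMap.comp_apply, AlgHom.toLinearMap_apply, key]

lemma contractCoeff_self (k i : ℕ) :
    contractCoeff k i i = ((-1) ^ i * i.factorial : ℝ) * mulFac k i := by
  rw [contractCoeff, if_pos rfl, mulFac, Nat.descFactorial_eq_factorial_mul_choose]
  push_cast
  rw [div_pow, one_pow]
  ring

lemma prod_contractCoeff_self {σ : Type*} [Fintype σ] (k : ℕ) (α : σ →₀ ℕ) :
    ∏ j, contractCoeff k (α j) (α j) = ((expCoeff (-1) α)⁻¹ : ℝ) * mulFacs k α := by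
  simp only [contractCoeff_self, Finset.prod_mul_distrib, mulFacs, expCoeff,
    Complex.ofReal_prod, Complex.ofReal_inv, ← Finset.prod_inv_distrib]
  congr 1
  refine Finset.prod_congr rfl fun j _ => ?_
  rw [← Complex.ofReal_inv, inv_div, div_eq_mul_inv, mul_comm, ← inv_pow, inv_neg, inv_one]

lemma expCoeff_ne_zero {σ : Type*} [Fintype σ] {ε : ℝ} (hε : ε ≠ 0) (α : σ →₀ ℕ) :
    expCoeff ε α ≠ 0 :=
  Finset.prod_ne_zero_iff.2 fun _ _ => div_ne_zero (pow_ne_zero _ hε)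
    (Nat.cast_ne_zero.2 (Nat.factorial_ne_zero _))

lemma isRealStable_or_zero_iff {σ : Type*} {f : MvPolynomial σ ℝ} :
    IsRealStable f ∨ f = 0 ↔ StableOrZero (map (algebraMap ℝ ℂ) f) := by
  rw [StableOrZero, isRealStable_iff,
    map_eq_zero_iff _ (map_injective _ (algebraMap ℝ ℂ).injective)]

/-- An operator whose symbol is in the Laguerre–Pólya class preserves real stability. -/
lemma preserves_of_symbol {T : MvPolynomial (Fin n) ℝ →ₗ[ℝ] MvPolynomial (Fin n) ℝ}
    {F : (Fin n ⊕ Fin n → ℂ) → ℂ}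
    (hF : ∀ x, HasSum (fun α : Fin n →₀ ℕ => transSymbolTermR (-1) T α x) (F x))
    (hL : InLaguerrePolyaR n F) {f : MvPolynomial (Fin n) ℝ} (hf : IsRealStable f) :
    IsRealStable (T f) ∨ T f = 0 := by
  obtain ⟨g, hg, hgF⟩ := hL
  choose R hR hRe using fun k => exists_contraction_eval (σ := Fin n) (τ := Fin n) k
  set f' := map (algebraMap ℝ ℂ) f with hf'
  have hf's : IsStable f' := isRealStable_iff.1 hf
  set g' := fun k => map (algebraMap ℝ ℂ) (g k) with hg'
  have hg's : ∀ k, IsStable (g' k) := fun k => isRealStable_iff.1 (hg k)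
  set t : (Fin n → ℂ) → (Fin n →₀ ℕ) → ℂ := fun z α =>
    expCoeff (-1) α * aeval z (T (monomial α 1)) with ht
  have hFt : ∀ z w, HasSum (fun α => t z α * ∏ i, w i ^ α i) (F (Sum.elim z w)) := fun z w => by
    have h := hF (Sum.elim z w)
    have e : ∀ α, transSymbolTermR (-1) T α (Sum.elim z w) = t z α * ∏ i, w i ^ α i := fun α => by
      have := transSymbolTermR_eq (-1) T α (Sum.elim z w)
      push_cast at this
      rw [this, ht]
      simp [mul_assoc]
    simpa only [e] using h
  have hcoeff : ∀ (α : Fin n →₀ ℕ) (K : Set (Fin n → ℂ)), IsCompact K →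
      TendstoUniformlyOn (fun k z => coeff α (evalLeft z (g' k))) (fun z => t z α) atTop K := by
    intro α K hK
    have hK' : IsCompact ((fun x : (Fin n → ℂ) × (Fin n → ℂ) => Sum.elim x.1 x.2) ''
        (K ×ˢ Metric.closedBall 0 1)) := by
      refine (hK.prod (isCompact_closedBall 0 1)).image (continuous_pi ?_)
      rintro (i | i)
      · exact (continuous_apply i).comp continuous_fst
      · exact (continuous_apply i).comp continuous_snd
    have hu := hgF _ hK'
    rw [Metric.tendstoUniformlyOn_iff] at hu ⊢
    intro ε hε
    filter_upwards [hu (ε / 2) (by positivity)] with k hk z hz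
    rw [dist_comm, dist_eq_norm]
    refine (norm_coeff_sub_le (hFt z) (ε := ε / 2) (fun w hw => ?_) α).trans_lt (by linarith)
    have h := hk _ ⟨(z, w), ⟨hz, by
      rw [mem_closedBall_zero_iff]
      exact (pi_norm_le_iff_of_nonneg zero_le_one).2 fun i => (hw i).le⟩, rfl⟩
    rw [dist_comm, dist_eq_norm] at h
    rw [eval_evalLeft, hg', eval_map, ← aeval_def]
    exact h.le
  rw [isRealStable_or_zero_iff]
  refine stableOrZero_of_tendsto
    (f := fun k => R k (rename Sum.inl (g' k) * rename Sum.inr f')) (Eventually.of_forall fun k =>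
      hR k _ (Or.inl fun x hx => ?_)) fun K hK => ?_
  · rw [map_mul, eval_rename, eval_rename]
    exact mul_ne_zero (hg's k _ fun i => hx _) (hf's _ fun i => hx _)
  simp only [hRe]
  have hlim : ∀ z, eval z (map (algebraMap ℝ ℂ) (T f)) =
      ∑ α ∈ f'.support, (((expCoeff (-1) α)⁻¹ : ℝ) : ℂ) * coeff α f' * t z α := fun z => by
    have hsupp : f'.support = f.support :=
      support_map_of_injective f (algebraMap ℝ ℂ).injective
    rw [hsupp]
    conv_lhs => rw [f.as_sum]
    simp only [map_sum]
    refine Finset.sum_congr rfl fun α _ => ?_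
    have hm : monomial α (coeff α f) = coeff α f • monomial α (1 : ℝ) := by
      rw [smul_monomial, smul_eq_mul, mul_one]
    have h0 : ((expCoeff (-1) α : ℝ) : ℂ) ≠ 0 :=
      Complex.ofReal_ne_zero.2 (expCoeff_ne_zero (by norm_num) α)
    rw [hm, map_smul, eval_map, ← aeval_def, map_smul, ht, hf', coeff_map, Complex.ofReal_inv,
      Complex.real_smul, Complex.coe_algebraMap]
    field_simp
  simp only [hlim]
  refine tendstoUniformlyOn_sum_mul hK _ (fun α _ => ?_) (fun α _ => ?_) fun α _ => hcoeff α K hK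
  · simp only [prod_contractCoeff_self]
    have h := (Complex.continuous_ofReal.tendsto 1).comp (tendsto_mulFacs α)
    simpa [Function.comp_def] using (h.const_mul (((expCoeff (-1) α)⁻¹ : ℝ) : ℂ)).mul_const
      (coeff α f')
  · exact ((continuous_aeval _).const_mul _).continuousOn

/-- The substitution of `-z` for `z`. -/
noncomputable def reflect (σ : Type*) : MvPolynomial σ ℝ →ₐ[ℝ] MvPolynomial σ ℝ :=
  aeval fun i => -X i

lemma aeval_reflect {σ : Type*} (z : σ → ℂ) (f : MvPolynomial σ ℝ) :
    aeval z (reflect σ f) = aeval (-z) f := by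
  induction f using MvPolynomial.induction_on with
  | C c => simp [reflect]
  | add p q hp hq => rw [map_add, map_add, hp, hq, map_add]
  | mul_X p i hp => simp_all [reflect]

lemma reflect_reflect {σ : Type*} (f : MvPolynomial σ ℝ) : reflect σ (reflect σ f) = f := by
  induction f using MvPolynomial.induction_on with
  | C c => simp [reflect]
  | add p q hp hq => rw [map_add, map_add, hp, hq]
  | mul_X p i hp => simp_all [reflect]

lemma reflect_monomial {σ : Type*} (α : σ →₀ ℕ) :
    reflect σ (monomial α 1) = (-1 : ℝ) ^ (α.sum fun _ k => k) • monomial α 1 := by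
  rw [reflect, aeval_monomial, map_one, one_mul, smul_monomial, smul_eq_mul, mul_one,
    monomial_eq, Finsupp.sum, ← Finset.prod_pow_eq_pow_sum, map_prod, Finsupp.prod, Finsupp.prod,
    ← Finset.prod_mul_distrib]
  refine Finset.prod_congr rfl fun i _ => ?_
  rw [neg_pow, map_pow, map_neg, map_one]

lemma isRealStable_reflect {σ : Type*} {f : MvPolynomial σ ℝ} (hf : IsRealStable f) :
    IsRealStable (reflect σ f) := fun z hz h => by
  rw [aeval_reflect] at h
  have h1 := eval_conj_map f (-z)
  rw [eval_map, ← aeval_def, eval_map, ← aeval_def, h, map_zero] at h1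
  exact hf _ (fun i => by simpa using hz i) h1

lemma transSymbolTermR_comp_reflect (T : MvPolynomial (Fin n) ℝ →ₗ[ℝ] MvPolynomial (Fin n) ℝ)
    (α : Fin n →₀ ℕ) (x : Fin n ⊕ Fin n → ℂ) :
    transSymbolTermR (-1) (T ∘ₗ (reflect (Fin n)).toLinearMap) α x = transSymbolTermR 1 T α x := by
  have h : ((-1 : ℂ) ^ (α.sum fun _ k => k)) * ((-1 : ℂ) ^ (α.sum fun _ k => k)) = 1 := by
    rw [← mul_pow]
    simp
  rw [transSymbolTermR, transSymbolTermR, LinearMap.comp_apply, AlgHom.toLinearMap_apply,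
    reflect_monomial, map_smul, map_smul, Complex.real_smul, one_pow]
  push_cast
  linear_combination (1 / (α.prod fun _ k => (k.factorial : ℂ)) *
    aeval (x ∘ Sum.inl) (T (monomial α 1)) * ∏ i, x (Sum.inr i) ^ α i) * h

end Sufficiency

end RealStability

/-- Theorem 4 (Borcea–Brändén): a linear operator
`T : ℝ[z₁,…,zₙ] → ℝ[z₁,…,zₙ]` preserves real stability if and only if either
(a) `T` has range of dimension at most two, being of the form
`T(f) = α(f)·P + β(f)·Q` with `P, Q` real stable and `P ≪ Q`, or
(b) `Ḡ_T(z,w)` converges on `ℂ^{2n}` to an entire function in the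
Laguerre–Pólya class in `2n` variables, or (c) `Ḡ_T(z,-w)` converges on
`ℂ^{2n}` to an entire function in the Laguerre–Pólya class. -/
theorem real_stability_preserver_transcendental (n : ℕ)
    (T : MvPolynomial (Fin n) ℝ →ₗ[ℝ] MvPolynomial (Fin n) ℝ) :
    (∀ f : MvPolynomial (Fin n) ℝ, IsRealStable f → IsRealStable (T f) ∨ T f = 0) ↔
      ((∃ (a b : MvPolynomial (Fin n) ℝ →ₗ[ℝ] ℝ) (P Q : MvPolynomial (Fin n) ℝ),
          IsRealStable P ∧ IsRealStable Q ∧ ProperPosition P Q ∧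
            ∀ f : MvPolynomial (Fin n) ℝ, T f = a f • P + b f • Q) ∨
        (∃ F : (Fin n ⊕ Fin n → ℂ) → ℂ,
          (∀ zw : Fin n ⊕ Fin n → ℂ,
            HasSum (fun α : Fin n →₀ ℕ => transSymbolTermR (-1) T α zw) (F zw)) ∧
          InLaguerrePolyaR n F) ∨
        (∃ F : (Fin n ⊕ Fin n → ℂ) → ℂ,
          (∀ zw : Fin n ⊕ Fin n → ℂ,
            HasSum (fun α : Fin n →₀ ℕ => transSymbolTermR 1 T α zw) (F zw)) ∧
          InLaguerrePolyaR n F)) := by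
  refine ⟨RealStability.rank_two_or_symbol_of_preserves, ?_⟩
  rintro (⟨a, b, P, Q, -, -, hPQ, hT⟩ | ⟨F, hF, hL⟩ | ⟨F, hF, hL⟩) f hf
  · rw [hT f, add_comm]
    exact RealStability.stableOrZero_combination hPQ _ _
  · exact RealStability.preserves_of_symbol hF hL hf
  · have h := RealStability.preserves_of_symbol
      (T := T ∘ₗ (RealStability.reflect (Fin n)).toLinearMap) (F := F)
      (fun x => by simpa only [RealStability.transSymbolTermR_comp_reflect] using hF x) hL
      (RealStability.isRealStable_reflect hf)
    rwa [LinearMap.comp_apply, AlgHom.toLinearMap_apply, RealStability.reflect_reflect] at h
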